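/- arXiv:2103.08017 — 10 statements merged into one kernel-verified Lean document; each statement's English description precedes it below -/
import Mathlib

section
/- Let 0 < m ≤ L be reals, κ = L/m, and set the heavy-ball parameters α = 4/(√L + √m)² and β = ((√κ − 1)/(√κ + 1))², with ρ = (√κ − 1)/(√κ + 1). For λ ∈ ℝ, let Â(λ) be the real 2×2 matrix [[0, 1], [−β, 1 + β − αλ]]. Then for every λ ∈ [m, L] and every integer t ≥ 1, the first row of Â(λ)^t satisfies (Â(λ)^t)₁₁² + (Â(λ)^t)₁₂² ≤ (t−1)²ρ^{2t} + t²ρ^{2(t−1)}, and this inequality holds with equality when λ = m. -/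
noncomputable def hbU (θ : ℝ) : ℕ → ℝ
  | 0 => 0
  | n + 1 => Real.cos θ * hbU θ n + Real.cos (n * θ)

lemma hbU_sin (θ : ℝ) (n : ℕ) : Real.sin θ * hbU θ n = Real.sin (n * θ) := by
  induction n with
  | zero => simp [hbU]
  | succ n ih =>
    have h : ((n + 1 : ℕ) : ℝ) * θ = n * θ + θ := by push_cast; ring
    rw [h, Real.sin_add, ← ih, hbU]; ring

lemma hbU_rec (θ : ℝ) (n : ℕ) :
    hbU θ (n + 2) = 2 * Real.cos θ * hbU θ (n + 1) - hbU θ n := by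
  have h : ((n + 1 : ℕ) : ℝ) * θ = n * θ + θ := by push_cast; ring
  have h1 : hbU θ (n + 2) = Real.cos θ * hbU θ (n + 1) + Real.cos ((n + 1 : ℕ) * θ) := rfl
  have h2 : hbU θ (n + 1) = Real.cos θ * hbU θ n + Real.cos (n * θ) := rfl
  rw [h1, h, Real.cos_add, ← hbU_sin, h2]
  linear_combination (-hbU θ n) * Real.sin_sq_add_cos_sq θ

lemma hbU_abs (θ : ℝ) (n : ℕ) : |hbU θ n| ≤ n := by
  induction n with
  | zero => simp [hbU]
  | succ n ih =>
    rw [hbU]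
    have h1 := abs_add_le (Real.cos θ * hbU θ n) (Real.cos (n * θ))
    have h2 := Real.abs_cos_le_one (n * θ)
    have h3 : |Real.cos θ * hbU θ n| ≤ 1 * n := by
      rw [abs_mul]
      exact mul_le_mul (Real.abs_cos_le_one θ) ih (abs_nonneg _) zero_le_one
    push_cast; linarith

lemma hbU_zero (n : ℕ) : hbU 0 n = n := by
  induction n with
  | zero => simp [hbU]
  | succ n ih => rw [hbU, ih]; simp

lemma hb_pow (ρ θ : ℝ) (n : ℕ) :
    ((!![0, 1; -ρ ^ 2, 2 * ρ * Real.cos θ] : Matrix (Fin 2) (Fin 2) ℝ) ^ (n + 1)) 0 0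
      = -ρ ^ (n + 1) * hbU θ n ∧
    ((!![0, 1; -ρ ^ 2, 2 * ρ * Real.cos θ] : Matrix (Fin 2) (Fin 2) ℝ) ^ (n + 1)) 0 1
      = ρ ^ n * hbU θ (n + 1) := by
  induction n with
  | zero => simp [hbU]
  | succ n ih =>
    obtain ⟨h0, h1⟩ := ih
    rw [pow_succ _ (n + 1), Matrix.mul_apply, Matrix.mul_apply, Fin.sum_univ_two,
      Fin.sum_univ_two, h0, h1, hbU_rec]
    constructor
    · simp; ring
    · simp; ring

/-- transient-growth bound for the modal matrices of Polyak's
heavy-ball method with optimal parameters, with equality at `λ = m`. -/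
theorem stmt_3 (m L : ℝ) (hm : 0 < m) (hmL : m ≤ L)
    (κ α β ρ : ℝ)
    (hκ : κ = L / m)
    (hα : α = 4 / (Real.sqrt L + Real.sqrt m) ^ 2)
    (hβ : β = ((Real.sqrt κ - 1) / (Real.sqrt κ + 1)) ^ 2)
    (hρ : ρ = (Real.sqrt κ - 1) / (Real.sqrt κ + 1))
    (A : ℝ → Matrix (Fin 2) (Fin 2) ℝ)
    (hA : ∀ lam : ℝ, A lam = !![0, 1; -β, 1 + β - α * lam]) :
    ∀ lam ∈ Set.Icc m L, ∀ t : ℕ, 1 ≤ t →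
      ((A lam ^ t) 0 0) ^ 2 + ((A lam ^ t) 0 1) ^ 2
        ≤ ((t : ℝ) - 1) ^ 2 * ρ ^ (2 * t) + (t : ℝ) ^ 2 * ρ ^ (2 * (t - 1))
      ∧ (lam = m →
        ((A lam ^ t) 0 0) ^ 2 + ((A lam ^ t) 0 1) ^ 2
          = ((t : ℝ) - 1) ^ 2 * ρ ^ (2 * t) + (t : ℝ) ^ 2 * ρ ^ (2 * (t - 1))) := by
  intro lam hlam t ht
  obtain ⟨n, rfl⟩ : ∃ n, t = n + 1 := ⟨t - 1, by omega⟩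
  have hr : 0 < Real.sqrt m := Real.sqrt_pos.2 hm
  have hs : Real.sqrt m ≤ Real.sqrt L := Real.sqrt_le_sqrt hmL
  have hr2 : Real.sqrt m ^ 2 = m := Real.sq_sqrt hm.le
  have hs2 : Real.sqrt L ^ 2 = L := Real.sq_sqrt (hm.le.trans hmL)
  have hk : Real.sqrt κ = Real.sqrt L / Real.sqrt m := by
    rw [hκ, Real.sqrt_div (hm.le.trans hmL)]
  have hβρ : β = ρ ^ 2 := by rw [hβ, hρ]
  have hρ' : ρ = (Real.sqrt L - Real.sqrt m) / (Real.sqrt L + Real.sqrt m) := by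
    rw [hρ, hk]; field_simp
  generalize Real.sqrt m = r at *
  generalize Real.sqrt L = s at *
  have hsr : 0 < s + r := by linarith
  have hρ0 : 0 ≤ ρ := by rw [hρ']; exact div_nonneg (by linarith) hsr.le
  have hα0 : 0 ≤ α := by rw [hα]; positivity
  have hαm : α * m = (1 - ρ) ^ 2 := by
    rw [hα, hρ', ← hr2]; field_simp; ring
  have hαL : α * L = (1 + ρ) ^ 2 := by
    rw [hα, hρ', ← hs2]; field_simp; ring
  have hu := mul_le_mul_of_nonneg_left hlam.1 hα0
  have hl := mul_le_mul_of_nonneg_left hlam.2 hα0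
  obtain ⟨θ, hθ, hθm⟩ : ∃ θ : ℝ, 1 + β - α * lam = 2 * ρ * Real.cos θ ∧ (lam = m → θ = 0) := by
    by_cases hlm : lam = m
    · refine ⟨0, ?_, fun _ => rfl⟩
      rw [hlm, hαm, hβρ, Real.cos_zero]; ring
    · rcases hρ0.eq_or_lt with h0 | h0
      · refine ⟨0, ?_, fun h => absurd h hlm⟩
        rw [hβρ]; rw [hαm] at hu; rw [hαL] at hl
        rw [← h0] at hu hl ⊢
        linarith
      · refine ⟨Real.arccos ((1 + β - α * lam) / (2 * ρ)), ?_, fun h => absurd h hlm⟩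
        rw [Real.cos_arccos]
        · field_simp
        · rw [le_div_iff₀ (by positivity)]; nlinarith
        · rw [div_le_iff₀ (by positivity)]; nlinarith
  obtain ⟨e0, e1⟩ := hb_pow ρ θ n
  rw [hA, hθ, hβρ, e0, e1]
  have hn : n + 1 - 1 = n := rfl
  rw [hn]
  push_cast
  constructor
  · have a := sq_le_sq' (abs_le.1 (hbU_abs θ n)).1 (abs_le.1 (hbU_abs θ n)).2
    have b := sq_le_sq' (abs_le.1 (hbU_abs θ (n + 1))).1 (abs_le.1 (hbU_abs θ (n + 1))).2
    push_cast at b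
    have a' := mul_le_mul_of_nonneg_left a (sq_nonneg (ρ ^ (n + 1)))
    have b' := mul_le_mul_of_nonneg_left b (sq_nonneg (ρ ^ n))
    calc _ = (ρ ^ (n + 1)) ^ 2 * hbU θ n ^ 2 + (ρ ^ n) ^ 2 * hbU θ (n + 1) ^ 2 := by ring
      _ ≤ _ := add_le_add a' b'
      _ = _ := by ring
  · intro h
    rw [hθm h, hbU_zero, hbU_zero]
    push_cast; ring
end

section
/- Let 0 < m ≤ L be reals, κ = L/m, and set the Nesterov parameters α = 4/(3L + m) and β = (√(3κ+1) − 2)/(√(3κ+1) + 2), with ρ = (√(3κ+1) − 2)/√(3κ+1). For λ ∈ ℝ, let Â(λ) be the real 2×2 matrix [[0, 1], [−β(1 − αλ), (1 + β)(1 − αλ)]]. Then for every λ ∈ [m, L] and every integer t ≥ 1, the first row of Â(λ)^t satisfies (Â(λ)^t)₁₁² + (Â(λ)^t)₁₂² ≤ (t−1)²ρ^{2t} + t²ρ^{2(t−1)}, and this inequality holds with equality when λ = m. -/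
/-- The scaled recurrence. -/
def pseq (u : ℝ) : ℕ → ℝ
  | 0 => 0
  | 1 => 1
  | (n + 2) => 2 * u * pseq u (n + 1) - u * pseq u n

theorem pseq_rec (u : ℝ) (n : ℕ) :
    pseq u (n + 2) = 2 * u * pseq u (n + 1) - u * pseq u n := rfl

theorem pseq_one (n : ℕ) : pseq 1 n = n ∧ pseq 1 (n + 1) = n + 1 := by
  induction n with
  | zero => simp [pseq]
  | succ k ih =>
    refine ⟨by rw [ih.2]; push_cast; ring, ?_⟩
    rw [pseq_rec, ih.1, ih.2]; push_cast; ring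

theorem pseq_inv (u : ℝ) (n : ℕ) :
    (pseq u (n + 1) - u * pseq u n) ^ 2 + (1 - u) * u * pseq u n ^ 2 = u ^ n := by
  induction n with
  | zero => simp [pseq]
  | succ k ih =>
    rw [pseq_rec, pow_succ u, ← ih]; ring

theorem pseq_bound_pos (u : ℝ) (h0 : 0 ≤ u) (h1 : u ≤ 1) (n : ℕ) : |pseq u n| ≤ n := by
  induction n with
  | zero => simp [pseq]
  | succ k ih =>
    have h := pseq_inv u k
    have hp : u ^ k ≤ 1 := pow_le_one₀ h0 h1
    have hq : 0 ≤ (1 - u) * u * pseq u k ^ 2 :=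
      mul_nonneg (mul_nonneg (by linarith) h0) (sq_nonneg _)
    have hc : |pseq u (k + 1) - u * pseq u k| ≤ 1 := by
      rw [← sq_le_one_iff_abs_le_one]; linarith
    have hu : |u * pseq u k| ≤ k := by
      rw [abs_mul, abs_of_nonneg h0]
      nlinarith [abs_nonneg (pseq u k)]
    push_cast
    rw [abs_le] at *
    constructor <;> linarith [hc.1, hc.2, hu.1, hu.2]

theorem pseq_bound_neg (u : ℝ) (h0 : u ≤ 0) (h1 : -(1 / 3) ≤ u) (n : ℕ) :
    |pseq u n| ≤ n ∧ |pseq u (n + 1)| ≤ n + 1 := by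
  induction n with
  | zero => simp [pseq]
  | succ k ih =>
    refine ⟨by push_cast; exact ih.2, ?_⟩
    rw [pseq_rec]
    have hu : |u| ≤ 1 / 3 := abs_le.2 ⟨by linarith, by linarith⟩
    have ha : |u * pseq u (k + 1)| ≤ 1 / 3 * (k + 1) := by
      rw [abs_mul]; exact mul_le_mul hu ih.2 (abs_nonneg _) (by norm_num)
    have hb : |u * pseq u k| ≤ 1 / 3 * k := by
      rw [abs_mul]; exact mul_le_mul hu ih.1 (abs_nonneg _) (by norm_num)
    push_cast
    rw [abs_le] at ha hb ⊢
    constructor <;> linarith [ha.1, ha.2, hb.1, hb.2]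

theorem pseq_bound (u : ℝ) (h0 : -(1 / 3) ≤ u) (h1 : u ≤ 1) (n : ℕ) : |pseq u n| ≤ n := by
  rcases le_total 0 u with h | h
  · exact pseq_bound_pos u h h1 n
  · exact (pseq_bound_neg u h h0 n).1

theorem row_pow (r u : ℝ) (n : ℕ) :
    (!![0, 1; -(r ^ 2 * u), 2 * r * u] ^ (n + 1) : Matrix (Fin 2) (Fin 2) ℝ) 0 0
        = -(r ^ (n + 1) * (u * pseq u n)) ∧
    (!![0, 1; -(r ^ 2 * u), 2 * r * u] ^ (n + 1) : Matrix (Fin 2) (Fin 2) ℝ) 0 1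
        = r ^ n * pseq u (n + 1) := by
  induction n with
  | zero => simp [pseq]
  | succ k ih =>
    rw [pow_succ _ (k + 1)]
    simp only [Matrix.mul_apply, Fin.sum_univ_two, ih.1, ih.2, pseq_rec]
    constructor <;> simp <;> ring

theorem param (m L : ℝ) (hm : 0 < m) (hmL : m ≤ L) (s : ℝ) (hs : 0 < s)
    (hs2 : s ^ 2 = 3 * (L / m) + 1) (lam : ℝ) (hl : m ≤ lam) (hl' : lam ≤ L) :
    ∃ u : ℝ, -(1 / 3) ≤ u ∧ u ≤ 1 ∧ (lam = m → u = 1) ∧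
      (s - 2) / (s + 2) * (1 - 4 / (3 * L + m) * lam) = ((s - 2) / s) ^ 2 * u ∧
      (1 + (s - 2) / (s + 2)) * (1 - 4 / (3 * L + m) * lam) = 2 * ((s - 2) / s) * u := by
  have hD : 3 * L + m = s ^ 2 * m := by rw [hs2]; field_simp
  have key : ∃ u : ℝ, -(1 / 3) ≤ u ∧ u ≤ 1 ∧ (lam = m → u = 1) ∧
      1 - 4 / (3 * L + m) * lam = u * ((s ^ 2 - 4) / s ^ 2) := by
    rcases hmL.eq_or_lt with h | h
    · refine ⟨1, by norm_num, le_rfl, fun _ => rfl, ?_⟩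
      have : lam = m := by linarith
      rw [hD, this]; field_simp
    · have hd : 0 < 3 * (L - m) := by linarith
      refine ⟨(3 * L + m - 4 * lam) / (3 * (L - m)), ?_, ?_, ?_, ?_⟩
      · rw [le_div_iff₀ hd]; linarith
      · rw [div_le_iff₀ hd]; linarith
      · rintro rfl; rw [div_eq_one_iff_eq hd.ne']; ring
      · have e : s ^ 2 - 4 = 3 * (L - m) / m := by rw [hs2]; field_simp; ring
        rw [e, hD]
        have : L - m ≠ 0 := by linarith
        field_simp
  obtain ⟨u, h1, h2, h3, h4⟩ := key
  refine ⟨u, h1, h2, h3, ?_, ?_⟩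
  · rw [h4]; field_simp; ring
  · rw [h4]; field_simp; ring

/-- transient-growth bound for the modal matrices of Nesterov's
accelerated method with optimal parameters, with equality at `λ = m`. -/
theorem stmt_4 (m L : ℝ) (hm : 0 < m) (hmL : m ≤ L)
    (κ α β ρ : ℝ)
    (hκ : κ = L / m)
    (hα : α = 4 / (3 * L + m))
    (hβ : β = (Real.sqrt (3 * κ + 1) - 2) / (Real.sqrt (3 * κ + 1) + 2))
    (hρ : ρ = (Real.sqrt (3 * κ + 1) - 2) / Real.sqrt (3 * κ + 1))
    (A : ℝ → Matrix (Fin 2) (Fin 2) ℝ)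
    (hA : ∀ lam : ℝ, A lam = !![0, 1; -(β * (1 - α * lam)), (1 + β) * (1 - α * lam)]) :
    ∀ lam ∈ Set.Icc m L, ∀ t : ℕ, 1 ≤ t →
      ((A lam ^ t) 0 0) ^ 2 + ((A lam ^ t) 0 1) ^ 2
        ≤ ((t : ℝ) - 1) ^ 2 * ρ ^ (2 * t) + (t : ℝ) ^ 2 * ρ ^ (2 * (t - 1))
      ∧ (lam = m →
        ((A lam ^ t) 0 0) ^ 2 + ((A lam ^ t) 0 1) ^ 2
          = ((t : ℝ) - 1) ^ 2 * ρ ^ (2 * t) + (t : ℝ) ^ 2 * ρ ^ (2 * (t - 1))) := by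
  intro lam hlam t ht
  obtain ⟨n, rfl⟩ : ∃ n, t = n + 1 := ⟨t - 1, by omega⟩
  have hκ1 : 0 < 3 * κ + 1 := by
    have : 0 < κ := by rw [hκ]; exact div_pos (by linarith) hm
    linarith
  obtain ⟨u, h1, h2, h3, h4, h5⟩ := param m L hm hmL (Real.sqrt (3 * κ + 1))
    (Real.sqrt_pos.2 hκ1) (by rw [Real.sq_sqrt hκ1.le, hκ]) lam hlam.1 hlam.2
  rw [← hβ, ← hα, ← hρ] at h4 h5
  rw [hA, h4, h5, (row_pow ρ u n).1, (row_pow ρ u n).2]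
  have e : ((n + 1 : ℕ) : ℝ) - 1 = n := by push_cast; ring
  have e2 : 2 * (n + 1 - 1) = n * 2 := by omega
  rw [e, e2, mul_comm 2 (n + 1), pow_mul, pow_mul, neg_sq,
    mul_pow (ρ ^ (n + 1)), mul_pow (ρ ^ n)]
  constructor
  · have ha : |u * pseq u n| ≤ n := by
      rw [abs_mul]
      have := pseq_bound u h1 h2 n
      have hu : |u| ≤ 1 := abs_le.2 ⟨by linarith, h2⟩
      nlinarith [abs_nonneg (pseq u n)]
    have hb := pseq_bound u h1 h2 (n + 1)
    have ha2 := sq_le_sq' (abs_le.1 ha).1 (abs_le.1 ha).2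
    have hb2 := sq_le_sq' (abs_le.1 hb).1 (abs_le.1 hb).2
    rw [mul_comm ((n : ℝ) ^ 2), mul_comm (((n + 1 : ℕ) : ℝ) ^ 2)]
    exact add_le_add (mul_le_mul_of_nonneg_left ha2 (sq_nonneg _))
      (mul_le_mul_of_nonneg_left hb2 (sq_nonneg _))
  · intro h
    rw [h3 h, (pseq_one n).1, (pseq_one n).2]
    push_cast; ring
end

section
/- Let ρ be a real number with 1/e ≤ ρ < 1 and define g(t) = √((t−1)²ρ^{2t} + t²ρ^{2t−2}) for real t ≥ 1. Then for every real t ≥ 1, g(t) ≤ −√2/(e·ρ·log ρ), and the supremum of g over [1, ∞) is at least −√2·ρ/(e·log ρ). -/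
lemma key_aux (L s : ℝ) (hL : 0 < L) : s * Real.exp (-(L * s)) ≤ 1 / (Real.exp 1 * L) := by
  have h := Real.add_one_le_exp (L * s - 1)
  rw [le_div_iff₀ (by positivity)]
  have h2 : Real.exp (L * s - 1) * (Real.exp (-(L * s)) * Real.exp 1) = 1 := by
    rw [← Real.exp_add, ← Real.exp_add, ← Real.exp_zero]; congr 1; ring
  have h3 : 0 < Real.exp (-(L * s)) * Real.exp 1 := by positivity
  nlinarith [mul_le_mul_of_nonneg_right h h3.le]

/-- for `ρ ∈ [1/e, 1)`, the transient amplification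
`g(t) = √((t−1)²ρ^{2t} + t²ρ^{2t−2})` is bounded above by `−√2/(e ρ log ρ)` on
`[1, ∞)`, and its supremum over `[1, ∞)` is at least `−√2 ρ/(e log ρ)`. -/
theorem stmt_5 (ρ : ℝ) (hρ₁ : 1 / Real.exp 1 ≤ ρ) (hρ₂ : ρ < 1)
    (g : ℝ → ℝ)
    (hg : ∀ t : ℝ, g t =
      Real.sqrt ((t - 1) ^ 2 * ρ ^ (2 * t) + t ^ 2 * ρ ^ (2 * t - 2))) :
    (∀ t : ℝ, 1 ≤ t → g t ≤ -(Real.sqrt 2 / (Real.exp 1 * ρ * Real.log ρ)))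
    ∧ -(Real.sqrt 2 * ρ / (Real.exp 1 * Real.log ρ)) ≤ sSup (g '' Set.Ici 1) := by
  have hρ : 0 < ρ := lt_of_lt_of_le (by positivity) hρ₁
  obtain ⟨L, hLdef⟩ : ∃ L, L = -Real.log ρ := ⟨_, rfl⟩
  have hlog : Real.log ρ = -L := by rw [hLdef]; ring
  have hL : 0 < L := by have := Real.log_neg hρ hρ₂; linarith
  have hexp : ρ = Real.exp (-L) := by rw [← hlog, Real.exp_log hρ]
  have hpow : ∀ x : ℝ, ρ ^ x = Real.exp (-(L * x)) := by
    intro x; rw [Real.rpow_def_of_pos hρ, hlog]; congr 1; ring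
  obtain ⟨M, hM⟩ : ∃ M, M = 1 / (Real.exp 1 * L) := ⟨_, rfl⟩
  have hM0 : 0 < M := by rw [hM]; positivity
  have hg2 : ∀ t : ℝ, g t = Real.sqrt ((ρ * ((t - 1) * Real.exp (-(L * (t - 1))))) ^ 2
      + (t * Real.exp (-(L * (t - 1)))) ^ 2) := by
    intro t
    rw [hg t, hpow, hpow]
    have e1 : Real.exp (-(L * (2 * t - 2))) = Real.exp (-(L * (t - 1))) ^ 2 := by
      rw [← Real.exp_nat_mul]; congr 1; push_cast; ring
    have e2 : Real.exp (-(L * (2 * t))) = (ρ * Real.exp (-(L * (t - 1)))) ^ 2 := by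
      rw [hexp, ← Real.exp_add, ← Real.exp_nat_mul]; congr 1; push_cast; ring
    rw [e1, e2]; congr 1; ring
  have hU : -(Real.sqrt 2 / (Real.exp 1 * ρ * Real.log ρ)) = Real.sqrt 2 * (M / ρ) := by
    rw [hlog, hM]; field_simp
  have hLo : -(Real.sqrt 2 * ρ / (Real.exp 1 * Real.log ρ)) = Real.sqrt 2 * (M * ρ) := by
    rw [hlog, hM]; field_simp
  have hub : ∀ t : ℝ, 1 ≤ t → g t ≤ Real.sqrt 2 * (M / ρ) := by
    intro t ht
    rw [hg2]
    apply Real.sqrt_le_iff.2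
    refine ⟨by positivity, ?_⟩
    rw [mul_pow (Real.sqrt 2), Real.sq_sqrt (by norm_num)]
    have k1 := key_aux L (t - 1) hL
    have k2 := key_aux L t hL
    rw [← hM] at k1 k2
    have hMr : M ≤ M / ρ := by rw [le_div_iff₀ hρ]; nlinarith
    have a0 : 0 ≤ (t - 1) * Real.exp (-(L * (t - 1))) :=
      mul_nonneg (by linarith) (Real.exp_pos _).le
    have a1 : ρ * ((t - 1) * Real.exp (-(L * (t - 1)))) ≤ M / ρ := by nlinarith
    have a2 : t * Real.exp (-(L * (t - 1))) ≤ M / ρ := by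
      rw [le_div_iff₀ hρ]
      have : t * Real.exp (-(L * (t - 1))) * ρ = t * Real.exp (-(L * t)) := by
        rw [hexp, mul_assoc, ← Real.exp_add]; congr 2; ring
      linarith
    have b1 := pow_le_pow_left₀ (mul_nonneg hρ.le a0) a1 2
    have b2 := pow_le_pow_left₀ (mul_nonneg (by linarith) (Real.exp_pos _).le) a2 2
    linarith
  rw [hU, hLo]
  refine ⟨hub, ?_⟩
  have hle : g (1 + 1 / L) ≤ sSup (g '' Set.Ici 1) := by
    apply le_csSup
    · refine ⟨Real.sqrt 2 * (M / ρ), ?_⟩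
      rintro _ ⟨t, ht, rfl⟩
      exact hub t ht
    · refine ⟨_, ?_, rfl⟩
      have : 0 < 1 / L := by positivity
      simp only [Set.mem_Ici]; linarith
  refine le_trans ?_ hle
  rw [hg2]
  apply Real.le_sqrt_of_sq_le
  rw [mul_pow (Real.sqrt 2), Real.sq_sqrt (by norm_num)]
  have e3 : Real.exp (-(L * (1 + 1 / L - 1))) = (Real.exp 1)⁻¹ := by
    rw [← Real.exp_neg]; congr 1; field_simp; ring
  rw [e3]
  have e4 : (1 + 1 / L - 1) * (Real.exp 1)⁻¹ = M := by rw [hM]; field_simp; ring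
  have e5 : (1 + 1 / L) * (Real.exp 1)⁻¹ = M + (Real.exp 1)⁻¹ := by rw [← e4]; ring
  rw [e4, e5]
  have h0 : 0 < (Real.exp 1)⁻¹ := by positivity
  have c : M * ρ ≤ M + (Real.exp 1)⁻¹ := by nlinarith
  have b := pow_le_pow_left₀ (by positivity) c 2
  nlinarith
end

section
/- Let ρ be a real number with 1/e ≤ ρ < 1 and define g(t) = √((t−1)²ρ^{2t} + t²ρ^{2t−2}) for real t ≥ 1. If t* ≥ 1 is a maximizer of g over [1, ∞), i.e. g(t*) ≥ g(t) for all t ≥ 1, then −1/log ρ ≤ t* ≤ 1 − 1/log ρ. -/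
lemma aux_h (L x y : ℝ) (hy : 0 < y) (hL : L ≠ 0) (hne : x ≠ y)
    (h : 0 ≤ (x - y) * (L * y - 1)) :
    x * Real.exp (-(L * x)) < y * Real.exp (-(L * y)) := by
  have h1 : L * (x - y) + 1 < Real.exp (L * (x - y)) :=
    Real.add_one_lt_exp (mul_ne_zero hL (sub_ne_zero.mpr hne))
  have h2 : x < y * Real.exp (L * (x - y)) := by
    have := mul_lt_mul_of_pos_left h1 hy
    nlinarith
  have h3 : Real.exp (-(L * y)) = Real.exp (L * (x - y)) * Real.exp (-(L * x)) := by
    rw [← Real.exp_add]; congr 1; ring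
  rw [h3, ← mul_assoc]
  exact mul_lt_mul_of_pos_right h2 (Real.exp_pos _)

/-- for `ρ ∈ [1/e, 1)`, any maximizer `t*` of the transient
amplification `g(t) = √((t−1)²ρ^{2t} + t²ρ^{2t−2})` over `[1, ∞)` satisfies
`−1/log ρ ≤ t* ≤ 1 − 1/log ρ`. -/
theorem stmt_6 (ρ : ℝ) (hρ₁ : 1 / Real.exp 1 ≤ ρ) (hρ₂ : ρ < 1)
    (g : ℝ → ℝ)
    (hg : ∀ t : ℝ, g t =
      Real.sqrt ((t - 1) ^ 2 * ρ ^ (2 * t) + t ^ 2 * ρ ^ (2 * t - 2)))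
    (tstar : ℝ) (htstar : 1 ≤ tstar)
    (hmax : ∀ t : ℝ, 1 ≤ t → g t ≤ g tstar) :
    -(1 / Real.log ρ) ≤ tstar ∧ tstar ≤ 1 - 1 / Real.log ρ := by
  have hρ : 0 < ρ := lt_of_lt_of_le (by positivity) hρ₁
  have hlog : Real.log ρ < 0 := Real.log_neg hρ hρ₂
  have hlog1 : -1 ≤ Real.log ρ := by
    rw [Real.le_log_iff_exp_le hρ, Real.exp_neg]
    simpa using hρ₁
  obtain ⟨L, hL⟩ : ∃ L, L = -Real.log ρ := ⟨_, rfl⟩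
  have hLpos : 0 < L := by linarith
  have hL1 : L ≤ 1 := by linarith
  obtain ⟨a, ha⟩ : ∃ a, a = 1 / L := ⟨_, rfl⟩
  have haL : L * a = 1 := by rw [ha]; field_simp
  have ha1 : 1 ≤ a := by rw [ha, le_div_iff₀ hLpos]; linarith
  have hal : 1 / Real.log ρ = -a := by
    rw [ha, hL, div_neg, neg_neg]
  have hF : ∀ t : ℝ, (t - 1) ^ 2 * ρ ^ (2 * t) + t ^ 2 * ρ ^ (2 * t - 2) =
      ((t - 1) * Real.exp (-(L * (t - 1)))) ^ 2 * Real.exp (-(2 * L)) +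
        (t * Real.exp (-(L * t))) ^ 2 * Real.exp (2 * L) := by
    intro t
    rw [Real.rpow_def_of_pos hρ, Real.rpow_def_of_pos hρ, mul_pow, mul_pow,
      ← Real.exp_nat_mul, ← Real.exp_nat_mul, mul_assoc, mul_assoc,
      ← Real.exp_add, ← Real.exp_add, hL]
    push_cast
    ring_nf
  have key : ∀ s : ℝ, 1 ≤ s →
      (tstar - 1) * Real.exp (-(L * (tstar - 1))) < (s - 1) * Real.exp (-(L * (s - 1))) →
      tstar * Real.exp (-(L * tstar)) < s * Real.exp (-(L * s)) → False := by
    intro s hs h1 h2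
    have hm := hmax s hs
    rw [hg, hg, hF, hF, Real.sqrt_le_sqrt_iff (by positivity)] at hm
    have e1 := pow_lt_pow_left₀ h1
      (mul_nonneg (by linarith) (Real.exp_pos _).le) two_ne_zero
    have e2 := pow_lt_pow_left₀ h2
      (mul_nonneg (by linarith) (Real.exp_pos _).le) two_ne_zero
    have e3 := mul_lt_mul_of_pos_right e1 (Real.exp_pos (-(2 * L)))
    have e4 := mul_lt_mul_of_pos_right e2 (Real.exp_pos (2 * L))
    linarith
  rw [hal]
  constructor
  · by_contra! hc
    refine key a ha1 (aux_h _ _ _ (by linarith) hLpos.ne' (by intro h; linarith) ?_)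
      (aux_h _ _ _ (by linarith) hLpos.ne' (by intro h; linarith) ?_)
    · nlinarith
    · rw [haL]; simp
  · by_contra! hc
    refine key (a + 1) (by linarith)
      (aux_h _ _ _ (by linarith) hLpos.ne' (by intro h; linarith) ?_)
      (aux_h _ _ _ (by linarith) hLpos.ne' (by intro h; linarith) ?_)
    · rw [add_sub_cancel_right, haL]; simp
    · nlinarith
end

section
/- Let 0 < m ≤ L, κ = L/m, and ρ = (√κ − 1)/(√κ + 1), and assume ρ ≥ 1/e. Define g(t) = √((t−1)²ρ^{2t} + t²ρ^{2t−2}) for real t ≥ 1. Then: (i) any maximizer t* of g over [1, ∞) satisfies (√κ − 1)/2 ≤ t* ≤ (√κ + 3)/2; (ii) the supremum of g over [1, ∞) lies between (√κ − 1)²/(√2·e·(√κ + 1)) and (√κ + 1)²/(√2·e·(√κ − 1)). -/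
lemma h_incr (a u v : ℝ) (ha : 0 < a) (huv : u < v) (hu : 0 ≤ u) (hv : a * v ≤ 1) :
    u * Real.exp (-a * u) < v * Real.exp (-a * v) := by
  have h1 : -(a * (v - u)) + 1 < Real.exp (-(a * (v - u))) :=
    Real.add_one_lt_exp (by nlinarith [mul_pos ha (sub_pos.2 huv)])
  have h2 : Real.exp (-a * v) = Real.exp (-(a * (v - u))) * Real.exp (-a * u) := by
    rw [← Real.exp_add]; ring_nf
  have h3 : u < v * Real.exp (-(a * (v - u))) := by
    have : v * (-(a * (v - u)) + 1) < v * Real.exp (-(a * (v - u))) :=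
      mul_lt_mul_of_pos_left h1 (by linarith)
    nlinarith [mul_nonneg (sub_pos.2 huv).le (sub_nonneg.2 hv)]
  rw [h2, ← mul_assoc]
  exact mul_lt_mul_of_pos_right h3 (Real.exp_pos _)

lemma h_decr (a u v : ℝ) (ha : 0 < a) (huv : u < v) (hu : 0 < u) (hv : 1 ≤ a * u) :
    v * Real.exp (-a * v) < u * Real.exp (-a * u) := by
  have h1 : a * (v - u) + 1 < Real.exp (a * (v - u)) :=
    Real.add_one_lt_exp (by nlinarith [mul_pos ha (sub_pos.2 huv)])
  have h2 : Real.exp (-a * u) = Real.exp (a * (v - u)) * Real.exp (-a * v) := by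
    rw [← Real.exp_add]; ring_nf
  have h3 : v < u * Real.exp (a * (v - u)) := by
    have : u * (a * (v - u) + 1) < u * Real.exp (a * (v - u)) :=
      mul_lt_mul_of_pos_left h1 hu
    nlinarith [mul_nonneg (sub_pos.2 huv).le (sub_nonneg.2 hv)]
  rw [h2, ← mul_assoc]
  exact mul_lt_mul_of_pos_right h3 (Real.exp_pos _)

lemma h_max (a b u : ℝ) (ha : 0 < a) (hab : a * b = 1) :
    u * Real.exp (-a * u) ≤ b * Real.exp (-1) := by
  have hb : 0 < b := by by_contra h; nlinarith
  have h1 : a * u ≤ Real.exp (a * u - 1) := by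
    have := Real.add_one_le_exp (a * u - 1); linarith
  have h2 : Real.exp (-1) = Real.exp (a * u - 1) * Real.exp (-a * u) := by
    rw [← Real.exp_add]; ring_nf
  have h3 : u ≤ b * Real.exp (a * u - 1) := by
    have := mul_le_mul_of_nonneg_left h1 hb.le
    have e : b * (a * u) = u := by rw [← mul_assoc, mul_comm b a, hab, one_mul]
    linarith
  rw [h2, ← mul_assoc]
  exact mul_le_mul_of_nonneg_right h3 (Real.exp_pos _).le

set_option maxHeartbeats 2000000
/-- for the heavy-ball rate `ρ = (√κ − 1)/(√κ + 1)` with `ρ ≥ 1/e`,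
any maximizer of `g(t) = √((t−1)²ρ^{2t} + t²ρ^{2t−2})` over `[1, ∞)` lies in
`[(√κ − 1)/2, (√κ + 3)/2]`, and the supremum of `g` over `[1, ∞)` lies between
`(√κ − 1)²/(√2 e (√κ + 1))` and `(√κ + 1)²/(√2 e (√κ − 1))`. -/
theorem stmt_7 (m L : ℝ) (hm : 0 < m) (hmL : m ≤ L)
    (κ ρ : ℝ) (hκ : κ = L / m)
    (hρ : ρ = (Real.sqrt κ - 1) / (Real.sqrt κ + 1))
    (hρe : 1 / Real.exp 1 ≤ ρ)
    (g : ℝ → ℝ)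
    (hg : ∀ t : ℝ, g t =
      Real.sqrt ((t - 1) ^ 2 * ρ ^ (2 * t) + t ^ 2 * ρ ^ (2 * t - 2))) :
    (∀ tstar : ℝ, 1 ≤ tstar → (∀ t : ℝ, 1 ≤ t → g t ≤ g tstar) →
       (Real.sqrt κ - 1) / 2 ≤ tstar ∧ tstar ≤ (Real.sqrt κ + 3) / 2)
    ∧ (Real.sqrt κ - 1) ^ 2 / (Real.sqrt 2 * Real.exp 1 * (Real.sqrt κ + 1))
        ≤ sSup (g '' Set.Ici 1)
    ∧ sSup (g '' Set.Ici 1)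
        ≤ (Real.sqrt κ + 1) ^ 2 / (Real.sqrt 2 * Real.exp 1 * (Real.sqrt κ - 1)) := by
  set s := Real.sqrt κ with hs
  have hs0 : 0 ≤ s := Real.sqrt_nonneg _
  have hρ0 : 0 < ρ := lt_of_lt_of_le (by positivity) hρe
  have hρs : ρ * (s + 1) = s - 1 := by rw [hρ]; field_simp
  have hs1 : 1 < s := by nlinarith [mul_pos hρ0 (by linarith : 0 < s + 1)]
  have hρ1 : ρ < 1 := by rw [hρ, div_lt_one (by linarith)]; linarith
  obtain ⟨a, haρ⟩ : ∃ a, ρ = Real.exp (-a) := ⟨-Real.log ρ, by rw [neg_neg, Real.exp_log hρ0]⟩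
  have ha : 0 < a := by
    rw [haρ, Real.exp_lt_one_iff] at hρ1; linarith
  have ha1 : a ≤ 1 := by
    rw [haρ, one_div, ← Real.exp_neg, Real.exp_le_exp] at hρe; linarith
  obtain ⟨b, hab⟩ : ∃ b, a * b = 1 := ⟨1 / a, by field_simp⟩
  have hb1 : 1 ≤ b := by by_contra h; nlinarith
  -- bounds on a
  have hal : 1 - ρ ≤ a := by
    have := Real.add_one_le_exp (-a); rw [← haρ] at this; linarith
  have hau : a * ρ ≤ 1 - ρ := by
    have h1 := Real.add_one_le_exp a
    have h2 : Real.exp a * ρ = 1 := by rw [haρ, ← Real.exp_add]; simp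
    nlinarith
  have hbu : b * (1 - ρ) ≤ 1 := by nlinarith
  have hbl : ρ ≤ b * (1 - ρ) := by
    have := mul_le_mul_of_nonneg_left hau (by linarith : 0 ≤ b)
    have e : b * (a * ρ) = ρ := by rw [← mul_assoc, mul_comm b a, hab, one_mul]
    linarith
  have hs2 : (1 - ρ) * (s + 1) = 2 := by linarith
  have hs3 : (1 - ρ) * (s - 1) = 2 * ρ := by linarith
  have hρ' : 0 < 1 - ρ := by linarith
  have hb2 : b ≤ (s + 1) / 2 := by
    by_contra h; push Not at h
    have := mul_lt_mul_of_pos_left h hρ'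
    nlinarith
  have hb3 : (s - 1) / 2 ≤ b := by
    by_contra h; push Not at h
    have := mul_lt_mul_of_pos_left h hρ'
    nlinarith
  -- g rewritten
  have hg' : ∀ t, g t = Real.sqrt ((ρ * ((t - 1) * Real.exp (-a * (t - 1)))) ^ 2
      + (Real.exp a * (t * Real.exp (-a * t))) ^ 2) := by
    intro t
    rw [hg, haρ, ← Real.exp_mul, ← Real.exp_mul]
    congr 1
    simp only [mul_pow, ← Real.exp_nat_mul]
    have e1 : Real.exp (-a * (2 * t)) =
        Real.exp ((2 : ℕ) * -a) * Real.exp ((2 : ℕ) * (-a * (t - 1))) := by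
      rw [← Real.exp_add]; congr 1; push_cast; ring
    have e2 : Real.exp (-a * (2 * t - 2)) =
        Real.exp ((2 : ℕ) * a) * Real.exp ((2 : ℕ) * (-a * t)) := by
      rw [← Real.exp_add]; congr 1; push_cast; ring
    rw [e1, e2]; ring
  have hea : Real.exp a = 1 / ρ := by rw [haρ, Real.exp_neg]; simp
  have hlt : ∀ t t' : ℝ, 1 ≤ t → 1 ≤ t' →
      (t - 1) * Real.exp (-a * (t - 1)) < (t' - 1) * Real.exp (-a * (t' - 1)) →
      t * Real.exp (-a * t) < t' * Real.exp (-a * t') → g t < g t' := by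
    intro t t' h1 h1' h2 h3
    rw [hg', hg']
    have p1 : 0 ≤ (t - 1) * Real.exp (-a * (t - 1)) :=
      mul_nonneg (by linarith) (Real.exp_pos _).le
    have p2 : 0 ≤ t * Real.exp (-a * t) := mul_nonneg (by linarith) (Real.exp_pos _).le
    have p3 := Real.exp_pos a
    apply Real.sqrt_lt_sqrt (by positivity)
    gcongr
  have hub : ∀ t : ℝ, 1 ≤ t →
      g t ≤ (s + 1) ^ 2 / (Real.sqrt 2 * Real.exp 1 * (s - 1)) := by
    intro t ht
    have hs1' : 0 < s - 1 := by linarith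
    rw [hg']
    apply Real.sqrt_le_iff.2 ⟨by positivity, ?_⟩
    have p1 : 0 ≤ (t - 1) * Real.exp (-a * (t - 1)) :=
      mul_nonneg (by linarith) (Real.exp_pos _).le
    have p2 : 0 ≤ t * Real.exp (-a * t) := mul_nonneg (by linarith) (Real.exp_pos _).le
    have q1 := h_max a b (t - 1) ha hab
    have q2 := h_max a b t ha hab
    have hr : ρ ≤ 1 / ρ := by rw [le_div_iff₀ hρ0]; nlinarith
    have hb0 : b ≤ 1 / (1 - ρ) := by rw [le_div_iff₀ hρ']; exact hbu
    have hsv : s + 1 = 2 / (1 - ρ) := by rw [eq_div_iff hρ'.ne']; linarith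
    have hsv' : s - 1 = 2 * ρ / (1 - ρ) := by rw [eq_div_iff hρ'.ne']; linarith
    have s2 : Real.sqrt 2 ^ 2 = 2 := Real.sq_sqrt (by norm_num)
    calc _ ≤ (1 / ρ * (1 / (1 - ρ) * Real.exp (-1))) ^ 2
          + (1 / ρ * (1 / (1 - ρ) * Real.exp (-1))) ^ 2 := by
          rw [hea]
          have q3 : b * Real.exp (-1) ≤ 1 / (1 - ρ) * Real.exp (-1) := by gcongr
          have q1' := q1.trans q3
          have q2' := q2.trans q3
          gcongr
      _ = _ := by
          rw [hsv, hsv', Real.exp_neg]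
          have := Real.exp_pos 1
          simp only [div_pow, mul_pow, s2]
          field_simp
          try rw [s2]
          try ring
  have hbdd : BddAbove (g '' Set.Ici 1) := by
    refine ⟨(s + 1) ^ 2 / (Real.sqrt 2 * Real.exp 1 * (s - 1)), ?_⟩
    rintro _ ⟨t, ht, rfl⟩
    exact hub t ht
  refine ⟨?_, ?_, ?_⟩
  · intro t ht hmax
    constructor
    · refine hb3.trans ?_
      by_contra h; push Not at h
      have := hlt t b ht hb1
        (h_incr a _ _ ha (by linarith) (by linarith) (by nlinarith))
        (h_incr a _ _ ha h (by linarith) hab.le)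
      linarith [hmax b hb1]
    · have : t ≤ b + 1 := by
        by_contra h; push Not at h
        have := hlt t (b + 1) ht (by linarith)
          (h_decr a _ _ ha (by linarith) (by linarith) (by nlinarith))
          (h_decr a _ _ ha h (by linarith) (by nlinarith))
        linarith [hmax (b + 1) (by linarith)]
      linarith
  · refine le_trans ?_ (le_csSup hbdd ⟨b, hb1, rfl⟩)
    rw [hg']
    apply Real.le_sqrt_of_sq_le
    have hsv : s + 1 = 2 / (1 - ρ) := by rw [eq_div_iff hρ'.ne']; linarith
    have hsv' : s - 1 = 2 * ρ / (1 - ρ) := by rw [eq_div_iff hρ'.ne']; linarith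
    have s2 : Real.sqrt 2 ^ 2 = 2 := Real.sq_sqrt (by norm_num)
    have e1 : ρ * ((b - 1) * Real.exp (-a * (b - 1))) = (b - 1) * Real.exp (-1) := by
      have : Real.exp (-1) = ρ * Real.exp (-a * (b - 1)) := by
        rw [haρ, ← Real.exp_add]; congr 1; linarith
      rw [this]; ring
    have e2 : Real.exp (-a * b) = Real.exp (-1) := by congr 1; linarith
    rw [e1, e2, hea]
    have key : 2 * ρ ^ 4 / (1 - ρ) ^ 2 ≤ (b - 1) ^ 2 + (b / ρ) ^ 2 := by
      rw [div_le_iff₀ (by positivity)]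
      have k1 : 1 ≤ b / ρ * (1 - ρ) := by
        rw [div_mul_eq_mul_div, le_div_iff₀ hρ0]; linarith
      have k2 : 1 ≤ (b / ρ) ^ 2 * (1 - ρ) ^ 2 := by
        rw [← mul_pow]; exact one_le_pow₀ k1
      have hsq : ρ ^ 2 ≤ 1 := by nlinarith
      have k3 : 2 * ρ ^ 4 ≤ (b - 1) ^ 2 * (1 - ρ) ^ 2 + 1 := by
        rcases le_total ρ (1 / 2) with h | h
        · have : ρ ^ 4 ≤ (1 / 2) ^ 4 := by gcongr
          have : 0 ≤ (b - 1) ^ 2 * (1 - ρ) ^ 2 := by positivity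
          norm_num at *
          linarith
        · have k4 : 2 * ρ - 1 ≤ (b - 1) * (1 - ρ) := by linarith
          have k5 : (2 * ρ - 1) ^ 2 ≤ ((b - 1) * (1 - ρ)) ^ 2 :=
            pow_le_pow_left₀ (by linarith) k4 2
          rw [mul_pow] at k5
          have k6 : 2 * ρ ^ 4 ≤ (2 * ρ - 1) ^ 2 + 1 := by
            have := mul_nonneg (sq_nonneg ρ) (sub_nonneg.2 hsq)
            have := sq_nonneg (1 - ρ)
            linarith
          exact k6.trans (add_le_add_left k5 1)
      linarith
    have key2 := mul_le_mul_of_nonneg_right key (sq_nonneg (Real.exp (-1)))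
    calc _ = 2 * ρ ^ 4 / (1 - ρ) ^ 2 * Real.exp (-1) ^ 2 := by
          rw [hsv, hsv', Real.exp_neg]
          have := Real.exp_pos 1
          simp only [div_pow, mul_pow, s2]
          field_simp
          try rw [s2]
          try ring
      _ ≤ _ := key2
      _ = _ := by ring
  · refine csSup_le (Set.nonempty_Ici.image g) ?_
    rintro _ ⟨t, ht, rfl⟩
    exact hub t ht
end

section
/- Let 0 < m ≤ L, κ = L/m, and ρ = (√(3κ+1) − 2)/√(3κ+1), and assume ρ ≥ 1/e. Define g(t) = √((t−1)²ρ^{2t} + t²ρ^{2t−2}) for real t ≥ 1. Then: (i) any maximizer t* of g over [1, ∞) satisfies (√(3κ+1) − 2)/2 ≤ t* ≤ (√(3κ+1) + 2)/2; (ii) the supremum of g over [1, ∞) lies between (√(3κ+1) − 2)²/(√2·e·√(3κ+1)) and (3κ + 1)/(√2·e·(√(3κ+1) − 2)). -/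
theorem aux_incr (l u v : ℝ) (hl : 0 < l) (hu : 0 ≤ u) (huv : u < v) (hv : v * l ≤ 1) :
    u * Real.exp (-(l * u)) < v * Real.exp (-(l * v)) := by
  have h1 : -(l * v) = -(l * u) + -(l * (v - u)) := by ring
  have hd : 0 < l * (v - u) := mul_pos hl (by linarith)
  have h2 := Real.add_one_lt_exp (x := -(l * (v - u))) (by linarith)
  rw [h1, Real.exp_add]
  have h3 := Real.exp_pos (-(l * u))
  have h4 : u < v * Real.exp (-(l * (v - u))) := by
    have := mul_lt_mul_of_pos_left h2 (show 0 < v by linarith)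
    nlinarith
  calc u * Real.exp (-(l * u)) < (v * Real.exp (-(l * (v - u)))) * Real.exp (-(l * u)) :=
        mul_lt_mul_of_pos_right h4 h3
    _ = _ := by ring

theorem aux_decr (l u v : ℝ) (hl : 0 < l) (hu : 0 < u) (huv : u < v) (hul : 1 ≤ u * l) :
    v * Real.exp (-(l * v)) < u * Real.exp (-(l * u)) := by
  have h1 : -(l * u) = -(l * v) + (l * (v - u)) := by ring
  have hd : 0 < l * (v - u) := mul_pos hl (by linarith)
  have h2 := Real.add_one_lt_exp (x := l * (v - u)) (by linarith)
  rw [h1, Real.exp_add]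
  have h3 := Real.exp_pos (-(l * v))
  have h4 : v < u * Real.exp (l * (v - u)) := by
    have := mul_lt_mul_of_pos_left h2 hu
    nlinarith
  calc v * Real.exp (-(l * v)) < (u * Real.exp (l * (v - u))) * Real.exp (-(l * v)) :=
        mul_lt_mul_of_pos_right h4 h3
    _ = _ := by ring

theorem aux_max (l x : ℝ) (hl : 0 < l) (hx : 0 ≤ x) :
    x * Real.exp (-(l * x)) ≤ 1 / l * (Real.exp 1)⁻¹ := by
  have e : 1 / l * (Real.exp 1)⁻¹ = 1 / l * Real.exp (-(l * (1 / l))) := by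
    rw [mul_one_div_cancel hl.ne', Real.exp_neg]
  rw [e]
  rcases lt_trichotomy x (1 / l) with h | h | h
  · exact (aux_incr l x (1 / l) hl hx h (by field_simp; rfl)).le
  · rw [h]
  · exact (aux_decr l (1 / l) x hl (by positivity) h (by field_simp; rfl)).le

/-- for the Nesterov rate `ρ = (√(3κ+1) − 2)/√(3κ+1)` with
`ρ ≥ 1/e`, any maximizer of `g(t) = √((t−1)²ρ^{2t} + t²ρ^{2t−2})` over `[1, ∞)`
lies in `[(√(3κ+1) − 2)/2, (√(3κ+1) + 2)/2]`, and the supremum of `g` over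
`[1, ∞)` lies between `(√(3κ+1) − 2)²/(√2 e √(3κ+1))` and
`(3κ + 1)/(√2 e (√(3κ+1) − 2))`. -/
theorem stmt_8 (m L : ℝ) (hm : 0 < m) (hmL : m ≤ L)
    (κ ρ : ℝ) (hκ : κ = L / m)
    (hρ : ρ = (Real.sqrt (3 * κ + 1) - 2) / Real.sqrt (3 * κ + 1))
    (hρe : 1 / Real.exp 1 ≤ ρ)
    (g : ℝ → ℝ)
    (hg : ∀ t : ℝ, g t =
      Real.sqrt ((t - 1) ^ 2 * ρ ^ (2 * t) + t ^ 2 * ρ ^ (2 * t - 2))) :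
    (∀ tstar : ℝ, 1 ≤ tstar → (∀ t : ℝ, 1 ≤ t → g t ≤ g tstar) →
       (Real.sqrt (3 * κ + 1) - 2) / 2 ≤ tstar
         ∧ tstar ≤ (Real.sqrt (3 * κ + 1) + 2) / 2)
    ∧ (Real.sqrt (3 * κ + 1) - 2) ^ 2
          / (Real.sqrt 2 * Real.exp 1 * Real.sqrt (3 * κ + 1))
        ≤ sSup (g '' Set.Ici 1)
    ∧ sSup (g '' Set.Ici 1)
        ≤ (3 * κ + 1) / (Real.sqrt 2 * Real.exp 1 * (Real.sqrt (3 * κ + 1) - 2)) := by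
  set s := Real.sqrt (3 * κ + 1) with hs
  have hκ0 : 0 < κ := by rw [hκ]; exact div_pos (by linarith) hm
  have hs2 : s ^ 2 = 3 * κ + 1 := Real.sq_sqrt (by linarith)
  have hs0 : 0 < s := Real.sqrt_pos.mpr (by linarith)
  have he := Real.exp_pos 1
  have hρ0 : 0 < ρ := lt_of_lt_of_le (by positivity) hρe
  have hρs : ρ * s = s - 2 := by rw [hρ]; field_simp
  have hs3 : 0 < s - 2 := by rw [← hρs]; positivity
  have hρ1 : ρ < 1 := by nlinarith
  rw [← hs2]
  obtain ⟨l, hl⟩ : ∃ l, l = -Real.log ρ := ⟨_, rfl⟩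
  have hlog : Real.log ρ = -l := by linarith
  have hl0 : 0 < l := by have := Real.log_neg hρ0 hρ1; linarith
  have hl1 : l ≤ 1 := by
    have := Real.log_le_log (by positivity) hρe
    rw [one_div, Real.log_inv, Real.log_exp] at this
    linarith
  have hlow : 1 / l ≤ s / 2 := by
    have := Real.log_le_sub_one_of_pos hρ0
    rw [div_le_div_iff₀ hl0 two_pos]
    nlinarith
  have hup : (s - 2) / 2 ≤ 1 / l := by
    have := Real.one_sub_inv_le_log_of_pos hρ0
    have h2 : l * ρ ≤ 1 - ρ := by
      have h3 : l ≤ ρ⁻¹ - 1 := by linarith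
      have := mul_le_mul_of_nonneg_right h3 hρ0.le
      rwa [sub_mul, inv_mul_cancel₀ hρ0.ne', one_mul] at this
    rw [div_le_div_iff₀ two_pos hl0, ← hρs]
    nlinarith
  have hT1 : 1 ≤ 1 / l := by rw [le_div_iff₀ hl0]; linarith
  have hTl : 1 / l * l = 1 := by field_simp
  set T := 1 / l with hT
  have hrp : ∀ x : ℝ, ρ ^ x = Real.exp (-(l * x)) := by
    intro x; rw [Real.rpow_def_of_pos hρ0, hlog]; congr 1; ring
  have hρexp : Real.exp (-l) = ρ := by rw [← hlog, Real.exp_log hρ0]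
  have hg' : ∀ t : ℝ, g t = Real.sqrt
      ((ρ * ((t - 1) * Real.exp (-(l * (t - 1))))) ^ 2
        + ((t * Real.exp (-(l * t))) / ρ) ^ 2) := by
    intro t
    rw [hg, hrp, hrp]
    congr 2
    · rw [← hρexp, show -(l * (2 * t)) = -l + -(l * (t-1)) + (-l + -(l * (t-1))) by ring]
      simp only [Real.exp_add]; ring
    · rw [← hρexp, div_eq_mul_inv, ← Real.exp_neg,
        show -(l * (2 * t - 2)) = -(l * t) + - -l + (-(l * t) + - -l) by ring]
      simp only [Real.exp_add]; ring
  have hlt : ∀ a b : ℝ, 1 ≤ a →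
      (a - 1) * Real.exp (-(l * (a - 1))) ≤ (b - 1) * Real.exp (-(l * (b - 1))) →
      a * Real.exp (-(l * a)) < b * Real.exp (-(l * b)) → g a < g b := by
    intro a b ha h1 h2
    rw [hg', hg']
    apply Real.sqrt_lt_sqrt (by positivity)
    have p1 : 0 ≤ (a - 1) * Real.exp (-(l * (a - 1))) :=
      mul_nonneg (by linarith) (Real.exp_pos _).le
    have p2 : 0 ≤ a * Real.exp (-(l * a)) := mul_nonneg (by linarith) (Real.exp_pos _).le
    apply add_lt_add_of_le_of_lt
    · gcongr
    · gcongr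
  have hub : ∀ t : ℝ, 1 ≤ t → g t ≤ s ^ 2 / (Real.sqrt 2 * Real.exp 1 * (s - 2)) := by
    intro t ht
    have a1 := aux_max l (t - 1) hl0 (by linarith)
    have a2 := aux_max l t hl0 (by linarith)
    have p1 : 0 ≤ (t - 1) * Real.exp (-(l * (t - 1))) :=
      mul_nonneg (by linarith) (Real.exp_pos _).le
    have p2 : 0 ≤ t * Real.exp (-(l * t)) := mul_nonneg (by linarith) (Real.exp_pos _).le
    have hM : 1 / l * (Real.exp 1)⁻¹ ≤ s / 2 * (Real.exp 1)⁻¹ := by gcongr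
    set M := s / 2 * (Real.exp 1)⁻¹ with hMd
    have hM0 : 0 ≤ M := by positivity
    rw [hg']
    apply Real.sqrt_le_iff.mpr
    refine ⟨by positivity, ?_⟩
    have e1 : ρ * ((t - 1) * Real.exp (-(l * (t - 1)))) ≤ M / ρ := by
      have : ρ * ((t - 1) * Real.exp (-(l * (t - 1)))) ≤ 1 * M := by
        gcongr
        exact a1.trans hM
      refine this.trans ?_
      rw [one_mul, le_div_iff₀ hρ0]
      nlinarith
    have e2 : (t * Real.exp (-(l * t))) / ρ ≤ M / ρ := by
      gcongr
      exact a2.trans hM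
    have e3 : (s ^ 2 / (Real.sqrt 2 * Real.exp 1 * (s - 2))) ^ 2 = (M / ρ) ^ 2 + (M / ρ) ^ 2 := by
      rw [hMd, ← hρs, div_pow, mul_pow, mul_pow, Real.sq_sqrt (show (0:ℝ) ≤ 2 by norm_num)]
      field_simp
      norm_num
    rw [e3]
    gcongr
  refine ⟨?_, ?_, ?_⟩
  · intro t ht hmax
    constructor
    · by_contra hc
      have htT : t < T := by linarith
      have := hlt t T ht (aux_incr l (t - 1) (T - 1) hl0 (by linarith) (by linarith)
        (by nlinarith)).le (aux_incr l t T hl0 (by linarith) htT hTl.le)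
      linarith [hmax T hT1]
    · by_contra hc
      have htT : T + 1 < t := by linarith
      have q : (t - 1) * Real.exp (-(l * (t - 1))) ≤
          (T + 1 - 1) * Real.exp (-(l * (T + 1 - 1))) :=
        (aux_decr l (T + 1 - 1) (t - 1) hl0 (by linarith) (by linarith) (by nlinarith)).le
      have := hlt t (T + 1) ht q (aux_decr l (T + 1) t hl0 (by linarith) htT (by nlinarith))
      linarith [hmax (T + 1) (by linarith)]
  · have hbdd : BddAbove (g '' Set.Ici 1) := by
      refine ⟨s ^ 2 / (Real.sqrt 2 * Real.exp 1 * (s - 2)), ?_⟩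
      · rintro _ ⟨t, ht, rfl⟩
        exact hub t ht
    refine le_trans ?_ (le_csSup hbdd ⟨T + 1, by simp only [Set.mem_Ici]; linarith, rfl⟩)
    rw [hg']
    apply Real.le_sqrt_of_sq_le
    have x1 : Real.exp (-(l * (T + 1 - 1))) = (Real.exp 1)⁻¹ := by
      rw [← Real.exp_neg]; congr 1; nlinarith
    have x2 : Real.exp (-(l * (T + 1))) = (Real.exp 1)⁻¹ * ρ := by
      rw [← hρexp, ← Real.exp_neg, ← Real.exp_add]; congr 1; nlinarith
    rw [x1, x2]
    have e3 : ((s - 2) ^ 2 / (Real.sqrt 2 * Real.exp 1 * s)) ^ 2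
        = (ρ * ((s - 2) / 2 * (Real.exp 1)⁻¹)) ^ 2 + (ρ * ((s - 2) / 2 * (Real.exp 1)⁻¹)) ^ 2 := by
      rw [hρ, div_pow, mul_pow, mul_pow, Real.sq_sqrt (show (0:ℝ) ≤ 2 by norm_num)]
      field_simp
      norm_num
    rw [e3]
    have e4 : (T + 1) * ((Real.exp 1)⁻¹ * ρ) / ρ = 1 * ((T + 1) * (Real.exp 1)⁻¹) := by
      field_simp
    rw [e4]
    have hh : (s - 2) / 2 ≤ T + 1 := by linarith
    have hh2 : (s - 2) / 2 ≤ T + 1 - 1 := by linarith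
    gcongr
  · refine csSup_le (Set.Nonempty.image g ⟨1, by simp⟩) ?_
    rintro _ ⟨t, ht, rfl⟩
    exact hub t ht
end

section
/- Let 0 < m ≤ L, κ = L/m, and let Q be a real symmetric n×n matrix with m·I ⪯ Q ⪯ L·I. Let x⋆ ∈ ℝⁿ and let f(x) = ½(x − x⋆)ᵀQ(x − x⋆), so ∇f(x) = Q(x − x⋆). Consider Nesterov's accelerated method with stepsize α = 1/L and momentum β = (√κ − 1)/(√κ + 1): x^{t+2} = x^{t+1} + β(x^{t+1} − x^t) − αQ(x^{t+1} + β(x^{t+1} − x^t) − x⋆), initialized with the balanced condition x¹ = x⁰. Then for every t ≥ 0, ‖x^t − x⋆‖ ≤ 3‖x⁰ − x⋆‖, where ‖·‖ is the Euclidean norm. -/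
open scoped InnerProductSpace in
theorem nesterov_aux {E : Type*} [NormedAddCommGroup E] [InnerProductSpace ℝ E]
    (P : E →ₗ[ℝ] E) (hs : ∀ u v, ⟪P u, v⟫_ℝ = ⟪u, P v⟫_ℝ)
    (h0 : ∀ u, 0 ≤ ⟪P u, u⟫_ℝ) (h1 : ∀ u, ⟪P u, u⟫_ℝ ≤ ⟪u, u⟫_ℝ)
    (β : ℝ) (hβ : β ^ 2 ≤ 1) (y : ℕ → E) (hb : y 1 = y 0)
    (hr : ∀ t, y (t + 2) = y (t + 1) + β • (y (t + 1) - y t)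
      - P (y (t + 1) + β • (y (t + 1) - y t))) (t : ℕ) :
    ∃ w, y (t + 1) - y t = P w ∧
      ⟪y (t + 1), y (t + 1)⟫_ℝ + ⟪P w, w⟫_ℝ ≤ ⟪y 0, y 0⟫_ℝ := by
  induction t with
  | zero => exact ⟨0, by simp [hb], by simp [hb]⟩
  | succ t ih =>
    obtain ⟨w, hw, hE⟩ := ih
    have hr' := hr t
    rw [hw] at hr'
    obtain ⟨z, hz⟩ : ∃ z, z = y (t + 1) + β • P w := ⟨_, rfl⟩
    rw [← hz] at hr'
    have hy : y (t + 1) = z - β • P w := by rw [hz]; abel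
    refine ⟨β • w - z, ?_, le_trans ?_ hE⟩
    · show y (t + 2) - y (t + 1) = _
      rw [hr', hy, map_sub, map_smul]; abel
    · show ⟪y (t + 2), y (t + 2)⟫_ℝ + _ ≤ _
      rw [hr', hy]
      have a1 := h1 (P z)
      have a2 := h0 (z - P z)
      have a3 := h0 w
      have a4 : 0 ≤ ⟪P w, P w⟫_ℝ := real_inner_self_nonneg
      have a5 : 0 ≤ (1 - β ^ 2) * ⟪P w, w⟫_ℝ := mul_nonneg (by linarith) a3
      have a6 : 0 ≤ β ^ 2 * ⟪P w, P w⟫_ℝ := mul_nonneg (by positivity) a4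
      have b1 : ⟪P (P z), z⟫_ℝ = ⟪P z, P z⟫_ℝ := hs _ _
      have b2 : ⟪P z, w⟫_ℝ = ⟪z, P w⟫_ℝ := hs _ _
      have b3 : ⟪P w, z⟫_ℝ = ⟪z, P w⟫_ℝ := real_inner_comm _ _
      have b4 : ⟪z, P z⟫_ℝ = ⟪P z, z⟫_ℝ := real_inner_comm _ _
      simp only [map_sub, map_smul, inner_sub_left, inner_sub_right, real_inner_smul_left,
        real_inner_smul_right, b1, b2, b3, b4] at a2 ⊢
      nlinarith

/-- Nesterov's accelerated method on a strongly convex quadratic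
`f(x) = ½(x − x⋆)ᵀQ(x − x⋆)` with `m·I ⪯ Q ⪯ L·I`, stepsize `α = 1/L`,
momentum `β = (√κ − 1)/(√κ + 1)`, and balanced initialization `x¹ = x⁰`,
satisfies `‖x^t − x⋆‖ ≤ 3‖x⁰ − x⋆‖` for all `t`. -/
theorem stmt_9 (n : ℕ) (m L : ℝ) (hm : 0 < m) (hmL : m ≤ L)
    (κ α β : ℝ) (hκ : κ = L / m) (hα : α = 1 / L)
    (hβ : β = (Real.sqrt κ - 1) / (Real.sqrt κ + 1))
    (Q : Matrix (Fin n) (Fin n) ℝ) (hsym : Q.IsSymm)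
    (hmQ : (Q - m • (1 : Matrix (Fin n) (Fin n) ℝ)).PosSemidef)
    (hQL : (L • (1 : Matrix (Fin n) (Fin n) ℝ) - Q).PosSemidef)
    (xstar : EuclideanSpace ℝ (Fin n))
    (x : ℕ → EuclideanSpace ℝ (Fin n))
    (hbal : x 1 = x 0)
    (hrec : ∀ t : ℕ, x (t + 2) = x (t + 1) + β • (x (t + 1) - x t)
        - α • (Matrix.toEuclideanLin Q (x (t + 1) + β • (x (t + 1) - x t) - xstar))) :
    ∀ t : ℕ, ‖x t - xstar‖ ≤ 3 * ‖x 0 - xstar‖ := by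
  have hL : 0 < L := hm.trans_le hmL
  have hκ1 : 1 ≤ Real.sqrt κ := by
    rw [Real.one_le_sqrt, hκ, le_div_iff₀ hm]; linarith
  have hβ0 : 0 ≤ β := by
    rw [hβ]; exact div_nonneg (by linarith) (by linarith)
  have hβ1 : β ≤ 1 := by
    rw [hβ, div_le_one (by linarith)]; linarith
  have hin : ∀ (M : Matrix (Fin n) (Fin n) ℝ) (u : EuclideanSpace ℝ (Fin n)),
      M.PosSemidef → 0 ≤ inner ℝ (Matrix.toEuclideanLin M u) u := by
    intro M u hM
    have := (Matrix.isPositive_toEuclideanLin_iff.2 hM).2 u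
    simpa using this
  have hα0 : 0 < α := by rw [hα]; positivity
  have key := nesterov_aux (α • Matrix.toEuclideanLin Q) (by
      intro u v
      have hH : Q.IsHermitian := by
        rw [Matrix.IsHermitian, Matrix.conjTranspose_eq_transpose_of_trivial]; exact hsym
      have := (Matrix.isSymmetric_toEuclideanLin_iff.2 hH) u v
      simp only [LinearMap.smul_apply, real_inner_smul_left, real_inner_smul_right, this])
    (by
      intro u
      have h := hin _ u hmQ
      have h2 : 0 ≤ m * inner ℝ u u := mul_nonneg hm.le real_inner_self_nonneg
      simp only [map_sub, map_smul, Matrix.toLpLin_one, LinearMap.sub_apply,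
        LinearMap.smul_apply, LinearMap.id_apply, inner_sub_left, real_inner_smul_left] at h ⊢
      exact mul_nonneg hα0.le (by linarith))
    (by
      intro u
      have h := hin _ u hQL
      simp only [map_sub, map_smul, Matrix.toLpLin_one, LinearMap.sub_apply,
        LinearMap.smul_apply, LinearMap.id_apply, inner_sub_left, real_inner_smul_left] at h ⊢
      rw [hα, one_div, inv_mul_le_iff₀ hL]; linarith)
    β (by nlinarith) (fun t => x t - xstar) (by simp [hbal]) (by
      intro t
      have e : x (t + 1) - xstar + β • (x (t + 1) - xstar - (x t - xstar))
          = x (t + 1) + β • (x (t + 1) - x t) - xstar := by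
        rw [sub_sub_sub_cancel_right]; abel
      simp only [e, LinearMap.smul_apply]
      rw [hrec t]; abel)
  have h0 : 0 ≤ ‖x 0 - xstar‖ := norm_nonneg _
  intro t
  cases t with
  | zero => linarith
  | succ t =>
    obtain ⟨w, hw, hE⟩ := key t
    have hp : 0 ≤ inner ℝ ((α • Matrix.toEuclideanLin Q) w) w := by
      have h := hin _ w hmQ
      have h2 : 0 ≤ m * inner ℝ w w := mul_nonneg hm.le real_inner_self_nonneg
      simp only [map_sub, map_smul, Matrix.toLpLin_one, LinearMap.sub_apply,
        LinearMap.smul_apply, LinearMap.id_apply, inner_sub_left, real_inner_smul_left] at h ⊢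
      exact mul_nonneg hα0.le (by linarith)
    simp only [real_inner_self_eq_norm_sq] at hE
    have : ‖x (t + 1) - xstar‖ ≤ ‖x 0 - xstar‖ :=
      (sq_le_sq₀ (norm_nonneg _) h0).1 (by linarith)
    linarith
end

section
/- Let 0 < m ≤ L with κ = L/m ≥ 1, and set the Nesterov parameters α = 4/(3L + m) and β = (√(3κ+1) − 2)/(√(3κ+1) + 2). For λ ∈ [m, L], let Â(λ) = [[0, 1], [−β(1 − αλ), (1 + β)(1 − αλ)]]. Then for every λ ∈ [m, L], every integer t ≥ 0, and every v ∈ ℝ², ‖Â(λ)^t v‖ ≤ (√(3κ+1) − 1)·‖v‖, where ‖·‖ is the Euclidean norm on ℝ². -/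
/-- Lucas-type sequence `h₀ = 0, h₁ = 1, h_{t+2} = b h_{t+1} - c h_t`. -/
def nestH (b c : ℝ) : ℕ → ℝ
  | 0 => 0
  | 1 => 1
  | (t + 2) => b * nestH b c (t + 1) - c * nestH b c t

lemma nestH_pow (b c : ℝ) (t : ℕ) :
    (!![0, 1; -c, b] : Matrix (Fin 2) (Fin 2) ℝ) ^ (t + 1) =
      !![-(c * nestH b c t), nestH b c (t + 1); -(c * nestH b c (t + 1)), nestH b c (t + 2)] := by
  induction t with
  | zero => simp [nestH]
  | succ t ih =>
    rw [pow_succ, ih]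
    ext i j
    fin_cases i <;> fin_cases j <;> simp [nestH, Matrix.mul_apply, Fin.sum_univ_two] <;> ring

lemma nestH_root (b c : ℝ) (μ ν : ℂ) (h1 : μ + ν = b) (h2 : μ * ν = c) (t : ℕ) :
    (nestH b c (t + 1) : ℂ) = μ * nestH b c t + ν ^ t := by
  induction t with
  | zero => simp [nestH]
  | succ t ih =>
    have : (nestH b c (t + 1 + 1) : ℂ) = b * nestH b c (t + 1) - c * nestH b c t := by
      simp [nestH]
    rw [this, ← h1, ← h2, pow_succ]
    linear_combination ν * ih

lemma nestH_bound (b c ρ : ℝ) (hρ : 0 ≤ ρ) (μ ν : ℂ) (h1 : μ + ν = b) (h2 : μ * ν = c)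
    (hμ : ‖μ‖ ≤ ρ) (hν : ‖ν‖ ≤ ρ) (t : ℕ) :
    |nestH b c (t + 1)| ≤ (t + 1) * ρ ^ t ∧ |nestH b c t| * ρ ≤ t * ρ ^ t := by
  have key : ∀ t, |nestH b c (t + 1)| ≤ ρ * |nestH b c t| + ρ ^ t := by
    intro t
    have h := nestH_root b c μ ν h1 h2 t
    have h3 : ‖(nestH b c (t + 1) : ℂ)‖ ≤ ‖μ‖ * ‖(nestH b c t : ℂ)‖ + ‖ν‖ ^ t := by
      rw [h]
      refine (norm_add_le _ _).trans ?_
      rw [norm_mul, norm_pow]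
    rw [Complex.norm_real, Complex.norm_real, Real.norm_eq_abs, Real.norm_eq_abs] at h3
    refine h3.trans ?_
    gcongr
  induction t with
  | zero => simp [nestH]
  | succ t ih =>
    have e : |nestH b c (t + 1)| * ρ ≤ ((t + 1 : ℕ) : ℝ) * ρ ^ (t + 1) := by
      have := mul_le_mul_of_nonneg_right ih.1 hρ
      push_cast
      rw [pow_succ]; linarith
    refine ⟨?_, e⟩
    have := key (t + 1)
    push_cast at e ⊢
    linarith

lemma nest_roots (ρ y : ℝ) (hρ : 0 ≤ ρ) (h1 : -ρ / 3 ≤ y) (h2 : y ≤ ρ) :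
    ∃ μ ν : ℂ, μ + ν = ((2 * y : ℝ) : ℂ) ∧ μ * ν = ((ρ * y : ℝ) : ℂ) ∧ ‖μ‖ ≤ ρ ∧ ‖ν‖ ≤ ρ := by
  rcases le_total 0 y with hy | hy
  · have hd : 0 ≤ ρ * y - y ^ 2 := by nlinarith
    have hs := Real.sq_sqrt hd
    set r := Real.sqrt (ρ * y - y ^ 2)
    refine ⟨⟨y, r⟩, ⟨y, -r⟩, ?_, ?_, ?_, ?_⟩
    · apply Complex.ext <;> simp; ring
    · apply Complex.ext <;> simp <;> nlinarith
    · rw [← sq_le_sq₀ (norm_nonneg _) hρ, Complex.sq_norm, Complex.normSq_mk]; nlinarith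
    · rw [← sq_le_sq₀ (norm_nonneg _) hρ, Complex.sq_norm, Complex.normSq_mk]; nlinarith
  · have hd : 0 ≤ y ^ 2 - ρ * y := by nlinarith
    have hs := Real.sq_sqrt hd
    have hr0 := Real.sqrt_nonneg (y ^ 2 - ρ * y)
    have hr : Real.sqrt (y ^ 2 - ρ * y) ≤ ρ + y := by
      apply Real.sqrt_le_iff.2
      constructor <;> nlinarith
    set r := Real.sqrt (y ^ 2 - ρ * y)
    refine ⟨((y + r : ℝ) : ℂ), ((y - r : ℝ) : ℂ), ?_, ?_, ?_, ?_⟩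
    · rw [← Complex.ofReal_add]; congr 1; ring
    · rw [← Complex.ofReal_mul]; congr 1; nlinarith
    · rw [Complex.norm_real, Real.norm_eq_abs, abs_le]; constructor <;> linarith
    · rw [Complex.norm_real, Real.norm_eq_abs, abs_le]; constructor <;> linarith

lemma nest_amgm (ρ : ℝ) (hρ : 0 ≤ ρ) (hρ1 : ρ < 1) (t : ℕ) :
    (t + 1) * ρ ^ t * (1 - ρ ^ 2) ≤ 1 - (ρ ^ (t + 1)) ^ 2 := by
  induction t with
  | zero => simp
  | succ t ih =>
    have a1 : ρ ^ (t + 1) ≤ 1 := pow_le_one₀ hρ hρ1.le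
    have a2 : ρ ^ (t + 2) ≤ 1 := pow_le_one₀ hρ hρ1.le
    have h3 : 0 ≤ (1 - ρ) * ((1 - ρ ^ (t + 1)) * (1 - ρ ^ (t + 2))) :=
      mul_nonneg (by linarith) (mul_nonneg (by linarith) (by linarith))
    have := mul_le_mul_of_nonneg_left ih hρ
    push_cast
    ring_nf at this h3 ⊢
    linarith

lemma nest_norm (p q r s : ℝ) (v : EuclideanSpace ℝ (Fin 2)) :
    ‖Matrix.toEuclideanLin (!![p, q; r, s] : Matrix (Fin 2) (Fin 2) ℝ) v‖ ≤
      (|p| + |q| + |r| + |s|) * ‖v‖ := by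
  have hn : ∀ w : EuclideanSpace ℝ (Fin 2), ‖w‖ ≤ |w 0| + |w 1| := by
    intro w
    rw [EuclideanSpace.norm_eq, Real.sqrt_le_iff]
    refine ⟨by positivity, ?_⟩
    simp only [Fin.sum_univ_two, Real.norm_eq_abs]
    nlinarith [abs_nonneg (w 0), abs_nonneg (w 1)]
  have h0 : |v 0| ≤ ‖v‖ := by simpa using PiLp.norm_apply_le v 0
  have h1 : |v 1| ≤ ‖v‖ := by simpa using PiLp.norm_apply_le v 1
  have b : ∀ x y : ℝ, |x * v 0 + y * v 1| ≤ (|x| + |y|) * ‖v‖ := by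
    intro x y
    refine (abs_add_le _ _).trans ?_
    rw [abs_mul, abs_mul, add_mul]
    gcongr
  refine (hn _).trans ?_
  have e0 : (Matrix.toEuclideanLin (!![p, q; r, s] : Matrix (Fin 2) (Fin 2) ℝ) v) 0
      = p * v 0 + q * v 1 := by
    simp [Matrix.toLpLin_apply, Matrix.mulVec, dotProduct, Fin.sum_univ_two]
  have e1 : (Matrix.toEuclideanLin (!![p, q; r, s] : Matrix (Fin 2) (Fin 2) ℝ) v) 1
      = r * v 0 + s * v 1 := by
    simp [Matrix.toLpLin_apply, Matrix.mulVec, dotProduct, Fin.sum_univ_two]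
  rw [e0, e1]
  linarith [b p q, b r s]

lemma nest_main (ρ y : ℝ) (hρ : 0 ≤ ρ) (hρ1 : ρ < 1) (h1 : -ρ / 3 ≤ y) (h2 : y ≤ ρ)
    (t : ℕ) (v : EuclideanSpace ℝ (Fin 2)) :
    ‖Matrix.toEuclideanLin ((!![0, 1; -(ρ * y), 2 * y] : Matrix (Fin 2) (Fin 2) ℝ) ^ t) v‖ ≤
      ((1 + ρ) / (1 - ρ)) * ‖v‖ := by
  have hp : 0 < 1 - ρ := by linarith
  cases t with
  | zero =>
    have : 1 ≤ (1 + ρ) / (1 - ρ) := by rw [le_div_iff₀ hp]; linarith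
    have h := mul_le_mul_of_nonneg_right this (norm_nonneg v)
    have e : Matrix.toEuclideanLin (1 : Matrix (Fin 2) (Fin 2) ℝ) v = v := by
      simp [Matrix.toLpLin_apply]
    rw [pow_zero, e]; linarith
  | succ t =>
    obtain ⟨μ, ν, e1, e2, hμ, hν⟩ := nest_roots ρ y hρ h1 h2
    have B := nestH_bound _ _ ρ hρ μ ν e1 e2 hμ hν
    obtain ⟨B1, B0⟩ := B t
    have B2 := (B (t + 1)).1
    rw [nestH_pow]
    refine (nest_norm _ _ _ _ v).trans ?_
    gcongr
    have hy : |y| ≤ ρ := abs_le.2 ⟨by linarith, h2⟩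
    simp only [abs_neg, abs_mul, abs_of_nonneg hρ]
    set H0 := |nestH (2 * y) (ρ * y) t|
    set H1 := |nestH (2 * y) (ρ * y) (t + 1)|
    set H2 := |nestH (2 * y) (ρ * y) (t + 2)|
    have i0 : ρ * |y| * H0 ≤ ρ * (t * ρ ^ t) := by
      calc ρ * |y| * H0 ≤ ρ * ρ * H0 := by gcongr
        _ = ρ * (H0 * ρ) := by ring
        _ ≤ _ := by gcongr
    have i1 : ρ * |y| * H1 ≤ ρ * ρ * ((t + 1) * ρ ^ t) := by gcongr
    have am := nest_amgm ρ hρ hρ1 t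
    have am' : (t + 1) * ρ ^ t * (1 - ρ ^ 2) ≤ 1 := am.trans (by nlinarith [sq_nonneg (ρ ^ (t + 1))])
    have am2 := mul_le_mul_of_nonneg_left am' (by linarith : 0 ≤ 1 + ρ)
    have sum : ρ * |y| * H0 + H1 + ρ * |y| * H1 + H2 ≤ (t + 1) * ρ ^ t * (1 + ρ) ^ 2 := by
      push_cast at B2
      rw [pow_succ] at B2
      have B2' : H2 ≤ (t + 1 + 1) * (ρ ^ t * ρ) := B2
      linarith
    rw [le_div_iff₀ hp]
    have := mul_le_mul_of_nonneg_right sum hp.le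
    linarith

/-- uniform bound `‖Â(λ)^t v‖ ≤ (√(3κ+1) − 1)‖v‖` on the powers
of the modal matrices of Nesterov's accelerated method with optimal parameters. -/
theorem stmt_14 (m L : ℝ) (hm : 0 < m) (hmL : m ≤ L)
    (κ α β : ℝ) (hκ : κ = L / m) (hκ1 : 1 ≤ κ)
    (hα : α = 4 / (3 * L + m))
    (hβ : β = (Real.sqrt (3 * κ + 1) - 2) / (Real.sqrt (3 * κ + 1) + 2))
    (A : ℝ → Matrix (Fin 2) (Fin 2) ℝ)
    (hA : ∀ lam : ℝ, A lam = !![0, 1; -(β * (1 - α * lam)), (1 + β) * (1 - α * lam)]) :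
    ∀ lam ∈ Set.Icc m L, ∀ (t : ℕ) (v : EuclideanSpace ℝ (Fin 2)),
      ‖Matrix.toEuclideanLin (A lam ^ t) v‖ ≤ (Real.sqrt (3 * κ + 1) - 1) * ‖v‖ := by
  rintro lam ⟨hl1, hl2⟩ t v
  have hs2 : Real.sqrt (3 * κ + 1) ^ 2 = 3 * κ + 1 := Real.sq_sqrt (by linarith)
  have hs : 2 ≤ Real.sqrt (3 * κ + 1) := Real.le_sqrt_of_sq_le (by linarith)
  set s := Real.sqrt (3 * κ + 1)
  have hs0 : 0 < s := by linarith
  have hL : L = κ * m := by rw [hκ]; field_simp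
  have hαm : α * m * s ^ 2 = 4 := by
    rw [hα, hs2, hL]; field_simp
  have hα0 : 0 < α := by rw [hα]; apply div_pos <;> linarith
  -- bounds on `x = 1 - α λ`
  have x2 : 1 - α * lam ≤ (s ^ 2 - 4) / s ^ 2 := by
    rw [le_div_iff₀ (by positivity)]
    have : α * m * s ^ 2 ≤ α * lam * s ^ 2 := by gcongr
    linarith
  have x1 : -((s ^ 2 - 4) / (3 * s ^ 2)) ≤ 1 - α * lam := by
    rw [neg_le, div_eq_mul_inv, ← div_eq_mul_inv, le_div_iff₀ (by positivity)]
    have h : α * lam * s ^ 2 ≤ α * (κ * m) * s ^ 2 := by rw [← hL]; gcongr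
    have h' : α * (κ * m) * s ^ 2 = 4 * κ := by linear_combination κ * hαm
    linarith
  set x := 1 - α * lam
  have hM : A lam = !![0, 1; -((1 - 2 / s) * (x * s / (s + 2))), 2 * (x * s / (s + 2))] := by
    rw [hA, hβ]
    congr 1
    ext i j
    fin_cases i <;> fin_cases j <;> simp <;> field_simp <;> ring
  have hb : s - 1 = (1 + (1 - 2 / s)) / (1 - (1 - 2 / s)) := by field_simp; ring
  rw [hM, hb]
  apply nest_main
  · rw [sub_nonneg, div_le_one hs0]; exact hs
  · have : 0 < 2 / s := by positivity
    linarith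
  · have : -(1 - 2 / s) / 3 = -((s ^ 2 - 4) / (3 * s ^ 2)) * s / (s + 2) := by field_simp; ring
    rw [this]; gcongr
  · have : (1 - 2 / s) = ((s ^ 2 - 4) / (s ^ 2)) * s / (s + 2) := by field_simp; ring
    rw [this]; gcongr
end

section
/- Let 0 < m ≤ L, κ = L/m, and let f: ℝⁿ → ℝ be a differentiable function that is m-strongly convex and whose gradient ∇f is L-Lipschitz continuous, with global minimizer x⋆. Consider Nesterov's accelerated method with stepsize α = 1/L and momentum β = (√κ − 1)/(√κ + 1): x^{t+2} = x^{t+1} + β(x^{t+1} − x^t) − α∇f(x^{t+1} + β(x^{t+1} − x^t)), with arbitrary initial points x⁰, x¹ ∈ ℝⁿ. Then for every t ≥ 0, ‖x^t − x⋆‖² ≤ 4κ‖x⁰ − x⋆‖² + 5κ‖x¹ − x⋆‖², where ‖·‖ is the Euclidean norm. -/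
section helpers
variable {E : Type*} [NormedAddCommGroup E] [InnerProductSpace ℝ E] [CompleteSpace E]

lemma line_deriv (f : E → ℝ) (g : E → E) (hgrad : ∀ y, HasGradientAt f (g y) y) (y v : E) (t : ℝ) :
    HasDerivAt (fun t : ℝ => f (y + t • v)) (inner ℝ (g (y + t • v)) v) t := by
  have h1 : HasDerivAt (fun t : ℝ => y + t • v) v t := by
    simpa using ((hasDerivAt_id t).smul_const v).const_add y
  have h2 := (hgrad (y + t • v)).hasFDerivAt.comp_hasDerivAt t h1
  simpa [Function.comp_def] using h2

lemma descent (f : E → ℝ) (g : E → E) (hgrad : ∀ y, HasGradientAt f (g y) y) (L : ℝ)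
    (hlip : ∀ y z, ‖g y - g z‖ ≤ L * ‖y - z‖) (y v : E) :
    f (y + v) ≤ f y + inner ℝ (g y) v + L / 2 * ‖v‖ ^ 2 := by
  have hd : ∀ t : ℝ, HasDerivAt
      (fun t : ℝ => f (y + t • v) - (t * inner ℝ (g y) v + L / 2 * ‖v‖ ^ 2 * t ^ 2))
      (inner ℝ (g (y + t • v)) v - (inner ℝ (g y) v + L / 2 * ‖v‖ ^ 2 * (2 * t))) t := by
    intro t
    refine (line_deriv f g hgrad y v t).sub (HasDerivAt.add ?_ ?_)
    · simpa using (hasDerivAt_id t).mul_const (inner ℝ (g y) v)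
    · simpa using ((hasDerivAt_id t).pow 2).const_mul (L / 2 * ‖v‖ ^ 2)
  have hanti := antitoneOn_of_deriv_nonpos (convex_Icc (0:ℝ) 1)
    (fun t _ => (hd t).continuousAt.continuousWithinAt)
    (fun t _ => (hd t).differentiableAt.differentiableWithinAt)
    (fun t ht => by
      rw [(hd t).deriv]
      rw [interior_Icc] at ht
      have h1 := real_inner_le_norm (g (y + t • v) - g y) v
      have h2 := hlip (y + t • v) y
      rw [add_sub_cancel_left, norm_smul, Real.norm_of_nonneg ht.1.le] at h2
      rw [inner_sub_left] at h1
      nlinarith [mul_le_mul_of_nonneg_right h2 (norm_nonneg v)])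
  have := hanti (by simp : (0:ℝ) ∈ Set.Icc (0:ℝ) 1) (by simp : (1:ℝ) ∈ Set.Icc (0:ℝ) 1) zero_le_one
  simp at this
  linarith

lemma strong (f : E → ℝ) (g : E → E) (hgrad : ∀ y, HasGradientAt f (g y) y) (m : ℝ)
    (hsc : ConvexOn ℝ Set.univ (fun y => f y - m / 2 * ‖y‖ ^ 2)) (y v : E) :
    f y + inner ℝ (g y) v + m / 2 * ‖v‖ ^ 2 ≤ f (y + v) := by
  have hexp : ∀ t : ℝ, ‖y + t • v‖ ^ 2 = ‖y‖ ^ 2 + 2 * t * inner ℝ y v + ‖v‖ ^ 2 * t ^ 2 := by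
    intro t
    rw [norm_add_sq_real, inner_smul_right, norm_smul, mul_pow, Real.norm_eq_abs, sq_abs]; ring
  have hc : ConvexOn ℝ Set.univ
      (fun t : ℝ => f (y + t • v) - m / 2 * ‖y + t • v‖ ^ 2) := by
    have := hsc.comp_affineMap (AffineMap.lineMap y (y + v) : ℝ →ᵃ[ℝ] E)
    simpa [Function.comp_def, AffineMap.lineMap_apply, add_comm] using this
  have hd : HasDerivAt (fun t : ℝ => f (y + t • v) - m / 2 * ‖y + t • v‖ ^ 2)
      (inner ℝ (g y) v - m / 2 * (2 * inner ℝ y v)) 0 := by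
    simp_rw [hexp]
    have h0 := line_deriv f g hgrad y v 0
    simp only [zero_smul, add_zero] at h0
    refine h0.sub (HasDerivAt.const_mul _ ?_)
    have h1 := (((hasDerivAt_id (0:ℝ)).const_mul 2).mul_const (inner ℝ y v)).const_add (‖y‖ ^ 2)
    have h2 := ((hasDerivAt_id (0:ℝ)).pow 2).const_mul (‖v‖ ^ 2)
    refine (h1.add h2).congr_deriv ?_
    simp
  have := hc.le_slope_of_hasDerivAt (Set.mem_univ 0) (Set.mem_univ 1) zero_lt_one hd
  rw [slope_def_field, hexp, hexp] at this
  simp at this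
  linarith

lemma lyap (f : E → ℝ) (g : E → E) (hgrad : ∀ y, HasGradientAt f (g y) y) (m s : ℝ)
    (hm : 0 < m) (hs : 1 ≤ s)
    (hsc : ConvexOn ℝ Set.univ (fun y => f y - m / 2 * ‖y‖ ^ 2))
    (hlip : ∀ y z, ‖g y - g z‖ ≤ (m * s ^ 2) * ‖y - z‖)
    (xs : E) (hmin : ∀ y, f xs ≤ f y) (p u y x' : E)
    (hy : y = u + ((s - 1) / (s + 1)) • (u - p))
    (hx : x' = y - (1 / (m * s ^ 2)) • g y) :
    f x' - f xs + m / 2 * ‖u + s • (x' - u) - xs‖ ^ 2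
      ≤ f u - f xs + m / 2 * ‖p + s • (u - p) - xs‖ ^ 2 := by
  have hs0 : 0 < s := by linarith
  have hs1 : s + 1 ≠ 0 := by positivity
  obtain ⟨D, hD⟩ : ∃ D, D = p + s • (u - p) - y := ⟨_, rfl⟩
  obtain ⟨Y, hY⟩ : ∃ Y, Y = y - xs := ⟨_, rfl⟩
  have hDy : D = s • (y - u) := by
    rw [hD, hy]
    match_scalars <;> field_simp <;> ring
  have e1 : x' = y + (-(1 / (m * s ^ 2))) • g y := by rw [hx]; module
  have e2 : u = y + (-(1 / s)) • D := by rw [hDy]; match_scalars <;> field_simp <;> ring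
  have e3 : xs = y + (-1 : ℝ) • Y := by rw [hY]; module
  have e4 : p + s • (u - p) - xs = Y + D := by rw [hD, hY]; module
  have e5 : u + s • (x' - u) - xs = Y + ((1 - 1 / s) • D + (-(1 / (m * s))) • g y) := by
    have : u + s • (x' - u) - xs = Y + (u - y + s • (y - u) + s • (x' - y)) := by
      rw [hY]; module
    rw [this, ← hDy, e1]
    nth_rewrite 1 [e2]
    match_scalars <;> field_simp <;> ring
  have h1 := descent f g hgrad _ hlip y ((-(1 / (m * s ^ 2))) • g y)
  have h2 := strong f g hgrad m hsc y ((-(1 / s)) • D)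
  have h3 := strong f g hgrad m hsc y ((-1 : ℝ) • Y)
  have h4 := hmin u
  rw [← e1] at h1
  rw [← e2] at h2
  rw [← e3] at h3
  rw [e4, e5]
  simp only [norm_add_sq_real, inner_add_right, inner_smul_right, inner_smul_left, norm_smul, mul_pow,
    Real.norm_eq_abs, sq_abs, real_inner_self_eq_norm_sq, RCLike.conj_to_real] at h1 h2 h3 ⊢
  rw [real_inner_comm (g y) Y, real_inner_comm (g y) D] at *
  generalize inner ℝ (g y) Y = a at *
  generalize inner ℝ (g y) D = b at *
  have hV : 0 ≤ ‖Y‖ ^ 2 + 2 * inner ℝ Y D + ‖D‖ ^ 2 := by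
    rw [← norm_add_sq_real]; positivity
  generalize inner ℝ Y D = c at *
  have hG := sq_nonneg ‖D‖

  generalize ‖g y‖ ^ 2 = G at *
  generalize ‖Y‖ ^ 2 = A at *
  generalize ‖D‖ ^ 2 = B at *
  obtain ⟨q, hq⟩ : ∃ q, q = 1 / s := ⟨_, rfl⟩
  obtain ⟨r, hr⟩ : ∃ r, r = 1 / m := ⟨_, rfl⟩
  have hq0 : 0 ≤ q := by rw [hq]; positivity
  have hq1 : 0 ≤ 1 - q := by
    rw [hq, sub_nonneg, div_le_one hs0]; exact hs
  have hr1 : 1 / (m * s) = q * r := by rw [hq, hr]; field_simp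
  have h1' : f x' ≤ f y - q ^ 2 * r / 2 * G := by
    refine h1.trans (le_of_eq ?_)
    rw [hq, hr]; field_simp; ring
  have hmr : m * r = 1 := by rw [hr]; field_simp
  rw [hr1, ← hq]
  rw [← hq] at h2
  have k2 := mul_le_mul_of_nonneg_left h2 hq1
  have k3 := mul_le_mul_of_nonneg_left h3 hq0
  have kV : 0 ≤ q * (f u - f xs + m / 2 * (A + 2 * c + B)) := by
    have : 0 ≤ m / 2 * (A + 2 * c + B) := by positivity
    exact mul_nonneg hq0 (by linarith)
  have kB : 0 ≤ m / 2 * ((1 - q) * (q + q ^ 2) * B) := by positivity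
  have hr2 : r = 1 / m := hr
  have key : m / 2 * (A + 2 * ((1 - q) * c + -(q * r) * a) +
      ((1 - q) ^ 2 * B + 2 * (-(q * r) * ((1 - q) * b)) + (-(q * r)) ^ 2 * G))
      = m / 2 * (A + 2 * (1 - q) * c + (1 - q) ^ 2 * B) - q * a - q * (1 - q) * b
        + q ^ 2 * r / 2 * G := by
    linear_combination (- q * a - q * (1 - q) * b + q ^ 2 * r / 2 * G) * hmr
  nlinarith [key]

end helpers


/-- for an `m`-strongly convex function `f` with `L`-Lipschitz
gradient `g` and minimizer `x⋆`, the iterates of Nesterov's accelerated method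
with `α = 1/L`, `β = (√κ − 1)/(√κ + 1)` satisfy
`‖x^t − x⋆‖² ≤ 4κ‖x⁰ − x⋆‖² + 5κ‖x¹ − x⋆‖²` for all `t`, where `κ = L/m`. -/
theorem stmt_18 (n : ℕ) (m L : ℝ) (hm : 0 < m) (hmL : m ≤ L)
    (κ α β : ℝ) (hκ : κ = L / m) (hα : α = 1 / L)
    (hβ : β = (Real.sqrt κ - 1) / (Real.sqrt κ + 1))
    (f : EuclideanSpace ℝ (Fin n) → ℝ)
    (g : EuclideanSpace ℝ (Fin n) → EuclideanSpace ℝ (Fin n))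
    (hgrad : ∀ y, HasGradientAt f (g y) y)
    (hsc : ConvexOn ℝ Set.univ (fun y => f y - m / 2 * ‖y‖ ^ 2))
    (hlip : ∀ y z, ‖g y - g z‖ ≤ L * ‖y - z‖)
    (xstar : EuclideanSpace ℝ (Fin n)) (hmin : ∀ y, f xstar ≤ f y)
    (x : ℕ → EuclideanSpace ℝ (Fin n))
    (hrec : ∀ t : ℕ, x (t + 2) = x (t + 1) + β • (x (t + 1) - x t)
        - α • g (x (t + 1) + β • (x (t + 1) - x t))) :
    ∀ t : ℕ, ‖x t - xstar‖ ^ 2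
      ≤ 4 * κ * ‖x 0 - xstar‖ ^ 2 + 5 * κ * ‖x 1 - xstar‖ ^ 2 := by
  have hL : 0 < L := by linarith
  have hκ1 : 1 ≤ κ := by rw [hκ, le_div_iff₀ hm]; linarith
  obtain ⟨s, hs⟩ : ∃ s, s = Real.sqrt κ := ⟨_, rfl⟩
  have hs1 : 1 ≤ s := by rw [hs]; exact Real.one_le_sqrt.mpr hκ1
  have hs2 : s ^ 2 = κ := by rw [hs]; exact Real.sq_sqrt (by linarith)
  have hLs : L = m * s ^ 2 := by rw [hs2, hκ]; field_simp
  rw [← hs] at hβ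
  rw [hLs] at hlip hα
  have hg0 : g xstar = 0 := by
    have h0 : IsLocalMin f xstar := Filter.Eventually.of_forall hmin
    have h := h0.hasFDerivAt_eq_zero (hgrad xstar).hasFDerivAt
    simpa using h
  have hV : ∀ t : ℕ, f (x (t + 1)) - f xstar + m / 2 * ‖x t + s • (x (t + 1) - x t) - xstar‖ ^ 2
      ≤ f (x 1) - f xstar + m / 2 * ‖x 0 + s • (x 1 - x 0) - xstar‖ ^ 2 := by
    intro t
    induction t with
    | zero => simp
    | succ t ih =>
      refine le_trans ?_ ih
      refine lyap f g hgrad m s hm hs1 hsc hlip xstar hmin _ _ _ _ rfl ?_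
      rw [← hβ, ← hα]
      exact hrec t
  have hb := descent f g hgrad _ hlip xstar (x 1 - xstar)
  rw [hg0, inner_zero_left, add_sub_cancel] at hb
  have hz : ‖x 0 + s • (x 1 - x 0) - xstar‖ ^ 2
      ≤ 2 * κ * ‖x 0 - xstar‖ ^ 2 + 2 * κ * ‖x 1 - xstar‖ ^ 2 := by
    have e : x 0 + s • (x 1 - x 0) - xstar = s • (x 1 - xstar) - (s - 1) • (x 0 - xstar) := by
      module
    have h1 : ‖x 0 + s • (x 1 - x 0) - xstar‖ ≤ s * (‖x 1 - xstar‖ + ‖x 0 - xstar‖) := by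
      rw [e]
      refine (norm_sub_le _ _).trans ?_
      rw [norm_smul, norm_smul, Real.norm_of_nonneg (by linarith), Real.norm_of_nonneg (by linarith)]
      nlinarith [norm_nonneg (x 0 - xstar)]
    have h2 := pow_le_pow_left₀ (norm_nonneg _) h1 2
    rw [mul_pow, hs2] at h2
    nlinarith [mul_nonneg (by linarith : 0 ≤ κ) (sq_nonneg (‖x 1 - xstar‖ - ‖x 0 - xstar‖))]
  have ha0 : 0 ≤ κ * ‖x 0 - xstar‖ ^ 2 := by positivity
  have hb0 : 0 ≤ κ * ‖x 1 - xstar‖ ^ 2 := by positivity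
  intro t
  cases t with
  | zero => nlinarith [sq_nonneg ‖x 0 - xstar‖]
  | succ t =>
    have hc := strong f g hgrad m hsc xstar (x (t + 1) - xstar)
    rw [hg0, inner_zero_left, add_sub_cancel] at hc
    have hv := hV t
    have hn : 0 ≤ m / 2 * ‖x t + s • (x (t + 1) - x t) - xstar‖ ^ 2 := by positivity
    rw [hs2] at hb
    have hz' := mul_le_mul_of_nonneg_left hz (by positivity : 0 ≤ m / 2)
    have : m / 2 * ‖x (t + 1) - xstar‖ ^ 2 ≤
        m / 2 * (2 * κ * ‖x 0 - xstar‖ ^ 2 + 3 * κ * ‖x 1 - xstar‖ ^ 2) := by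
      linarith
    have := le_of_mul_le_mul_left this (by positivity)
    linarith
end

section
/- Let 0 < m ≤ L, κ = L/m, and set α = 1/L, β = (√κ − 1)/(√κ + 1). There exist a dimension n, a differentiable function f: ℝⁿ → ℝ that is m-strongly convex with L-Lipschitz gradient and global minimizer x⋆ (one may take f quadratic), initial points x⁰, x¹ ∈ ℝⁿ with ‖x⁰ − x⋆‖² + ‖x¹ − x⋆‖² > 0, and an iteration t ≥ 0, such that the Nesterov iterates x^{t+2} = x^{t+1} + β(x^{t+1} − x^t) − α∇f(x^{t+1} + β(x^{t+1} − x^t)) satisfy ‖x^t − x⋆‖ ≥ (√2·(√κ − 1)²/(e·√κ)) · √(‖x⁰ − x⋆‖² + ‖x¹ − x⋆‖²). -/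
lemma growth_key (p : ℝ) (hp : 0 ≤ p) : ∃ u : ℕ, 0 < ((u : ℝ) + 1) * (p / (p + 1)) ^ u ∧
    2 * p ^ 4 / (Real.exp 1 ^ 2 * (p + 1) ^ 2) ≤
      (((u : ℝ) + 1) * (p / (p + 1)) ^ u) ^ 2 + ((u : ℝ) * (p / (p + 1)) ^ (u + 1)) ^ 2 := by
  have he : (2 : ℝ) ≤ Real.exp 1 := by
    have := Real.add_one_le_exp (1 : ℝ); linarith
  by_cases h1 : p < 1
  · refine ⟨0, by simp, ?_⟩
    simp only [Nat.cast_zero, zero_add, pow_zero, mul_one, zero_mul, one_pow]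
    rw [div_le_iff₀ (by positivity)]
    have h4 : p ^ 4 ≤ 1 := pow_le_one₀ hp h1.le
    have h5 : (4 : ℝ) ≤ Real.exp 1 ^ 2 := by nlinarith
    have h6 : (1 : ℝ) ≤ (p + 1) ^ 2 := by nlinarith
    nlinarith
  push Not at h1
  have hp0 : 0 < p := by linarith
  obtain ⟨k, hk⟩ : ∃ k : ℕ, ⌊p⌋₊ = k + 1 :=
    Nat.exists_eq_succ_of_ne_zero (Nat.floor_pos.mpr h1).ne'
  have hl : ((k : ℝ) + 1) ≤ p := by
    have := Nat.floor_le hp; rw [hk] at this; push_cast at this; exact this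
  have hr : p ≤ (k : ℝ) + 2 := by
    have := (Nat.lt_floor_add_one p).le; rw [hk] at this; push_cast at this; linarith
  have hk0 : (0 : ℝ) ≤ k := Nat.cast_nonneg k
  refine ⟨k + 1, by positivity, ?_⟩
  push_cast
  set ρ := p / (p + 1) with hρ
  have hρ0 : 0 < ρ := by positivity
  have hA : Real.exp (-(1 / p)) ≤ ρ := by
    rw [Real.exp_neg]
    have h : 1 / p + 1 ≤ Real.exp (1 / p) := Real.add_one_le_exp _
    have h2 : ρ = (1 / p + 1)⁻¹ := by rw [hρ]; field_simp; ring
    rw [h2]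
    exact inv_anti₀ (by positivity) h
  have hB : 3 - (2 * k + 1) / p ≤ Real.exp 1 ^ 2 * ρ ^ (2 * k + 1) := by
    have h1 : Real.exp (-(1 / p)) ^ (2 * k + 1) ≤ ρ ^ (2 * k + 1) :=
      pow_le_pow_left₀ (Real.exp_pos _).le hA _
    calc 3 - (2 * k + 1) / p = (2 - (2 * k + 1) / p) + 1 := by ring
      _ ≤ Real.exp (2 - (2 * k + 1) / p) := Real.add_one_le_exp _
      _ = Real.exp 1 ^ 2 * Real.exp (-(1 / p)) ^ (2 * k + 1) := by
        rw [← Real.exp_nat_mul, ← Real.exp_nat_mul, ← Real.exp_add]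
        congr 1; push_cast; ring
      _ ≤ _ := by gcongr
  have hC : p ^ 2 ≤ ((k : ℝ) + 1) * (k + 2) * (3 - (2 * k + 1) / p) := by
    have : 3 - (2 * k + 1) / p = (3 * p - (2 * k + 1)) / p := by field_simp
    rw [this, ← mul_div_assoc, le_div_iff₀ hp0]
    obtain ⟨d, rfl⟩ : ∃ d, p = k + 1 + d := ⟨p - k - 1, by ring⟩
    have hd0 : 0 ≤ d := by linarith
    have hd1 : d ≤ 1 := by linarith
    have hd2 : d ^ 2 ≤ d := by nlinarith
    have hd3 : d ^ 3 ≤ d := by nlinarith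
    nlinarith [mul_nonneg hk0 hd0, mul_nonneg hk0 (sub_nonneg.2 hd1), mul_nonneg hk0 (sub_nonneg.2 hd2),
      mul_nonneg (mul_nonneg hk0 hk0) (sub_nonneg.2 hd1), mul_nonneg (mul_nonneg hk0 hk0) hd0]
  have hD : p ^ 2 ≤ ((k : ℝ) + 1) * (k + 2) * (Real.exp 1 ^ 2 * ρ ^ (2 * k + 1)) :=
    hC.trans (by gcongr)
  have hE : 2 * p ^ 4 / (Real.exp 1 ^ 2 * (p + 1) ^ 2) = 2 * ρ ^ 2 * (p ^ 2 / Real.exp 1 ^ 2) := by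
    rw [hρ]; field_simp
  have hF : p ^ 2 / Real.exp 1 ^ 2 ≤ ((k : ℝ) + 1) * (k + 2) * ρ ^ (2 * k + 1) := by
    rw [div_le_iff₀ (by positivity)]; linarith
  rw [hE]
  calc 2 * ρ ^ 2 * (p ^ 2 / Real.exp 1 ^ 2)
      ≤ 2 * ρ ^ 2 * (((k : ℝ) + 1) * (k + 2) * ρ ^ (2 * k + 1)) := by gcongr
    _ = 2 * (((k : ℝ) + 1 + 1) * ρ ^ (k + 1)) * (((k : ℝ) + 1) * ρ ^ (k + 1 + 1)) := by ring
    _ ≤ _ := two_mul_le_add_sq _ _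

/-- lower bound on the worst-case transient growth of Nesterov's
accelerated method with `α = 1/L`, `β = (√κ − 1)/(√κ + 1)` over the class of
`m`-strongly convex `L`-smooth functions: there exist an instance (which may be
taken quadratic), initial points, and an iteration `t` at which
`‖x^t − x⋆‖ ≥ (√2 (√κ − 1)²/(e √κ)) √(‖x⁰ − x⋆‖² + ‖x¹ − x⋆‖²)`. -/
theorem stmt_19 (m L : ℝ) (hm : 0 < m) (hmL : m ≤ L)
    (κ α β : ℝ) (hκ : κ = L / m) (hα : α = 1 / L)
    (hβ : β = (Real.sqrt κ - 1) / (Real.sqrt κ + 1)) :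
    ∃ (n : ℕ) (f : EuclideanSpace ℝ (Fin n) → ℝ)
      (g : EuclideanSpace ℝ (Fin n) → EuclideanSpace ℝ (Fin n))
      (xstar : EuclideanSpace ℝ (Fin n))
      (x : ℕ → EuclideanSpace ℝ (Fin n)) (t : ℕ),
      (∀ y, HasGradientAt f (g y) y)
      ∧ ConvexOn ℝ Set.univ (fun y => f y - m / 2 * ‖y‖ ^ 2)
      ∧ (∀ y z, ‖g y - g z‖ ≤ L * ‖y - z‖)
      ∧ (∀ y, f xstar ≤ f y)
      ∧ (∀ s : ℕ, x (s + 2) = x (s + 1) + β • (x (s + 1) - x s)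
          - α • g (x (s + 1) + β • (x (s + 1) - x s)))
      ∧ 0 < ‖x 0 - xstar‖ ^ 2 + ‖x 1 - xstar‖ ^ 2
      ∧ Real.sqrt 2 * (Real.sqrt κ - 1) ^ 2 / (Real.exp 1 * Real.sqrt κ)
            * Real.sqrt (‖x 0 - xstar‖ ^ 2 + ‖x 1 - xstar‖ ^ 2)
          ≤ ‖x t - xstar‖ := by
  have hL : 0 < L := by linarith
  have hκ1 : 1 ≤ κ := by rw [hκ, le_div_iff₀ hm]; linarith
  set s := Real.sqrt κ with hs
  have hs1 : 1 ≤ s := by rw [hs]; exact Real.one_le_sqrt.mpr hκ1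
  have hs0 : 0 < s := by linarith
  have hss : s ^ 2 = κ := Real.sq_sqrt (by linarith)
  have hαm : α * m = 1 / s ^ 2 := by rw [hss, hκ, hα]; field_simp
  obtain ⟨u, hA0, hu⟩ := growth_key (s - 1) (by linarith)
  rw [sub_add_cancel] at hu hA0
  set ρ := (s - 1) / s with hρ
  set A : ℝ := ((u : ℝ) + 1) * ρ ^ u with hA
  set B : ℝ := (u : ℝ) * ρ ^ (u + 1) with hB
  let c : ℕ → ℝ := fun k => k * ρ ^ (k - 1) * A + ((k : ℝ) - 1) * ρ ^ k * B
  have hc : ∀ k, c (k + 2) = 2 * ρ * c (k + 1) - ρ ^ 2 * c k := by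
    intro k
    rcases k with _ | k
    · norm_num [c]; try ring_nf
      try simp
    · simp only [c, Nat.add_sub_cancel, show k + 1 + 2 - 1 = k + 2 from rfl]
      push_cast; ring
  have hc0 : c 0 = -B := by simp [c]
  have hc1 : c 1 = A := by simp [c]
  have hcu : c (u + 1) = A ^ 2 + B ^ 2 := by
    simp only [c, Nat.add_sub_cancel, hA, hB]; push_cast; ring
  have h2ρ : (1 - α * m) * (1 + β) = 2 * ρ := by
    rw [hαm, hβ, hρ]; field_simp; ring
  have hρ2 : (1 - α * m) * β = ρ ^ 2 := by
    rw [hαm, hβ, hρ]; field_simp; ring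
  -- positivity of the initial data
  have hpos : 0 < A ^ 2 + B ^ 2 := by
    positivity
  let e : EuclideanSpace ℝ (Fin 1) := EuclideanSpace.single 0 1
  have he : ‖e‖ = 1 := by simp [e]
  have hne : ∀ r : ℝ, ‖r • e - 0‖ = |r| := by intro r; simp [norm_smul, he]
  refine ⟨1, fun y => m / 2 * ‖y‖ ^ 2, fun y => m • y, 0, fun k => c k • e, u + 1,
    ?_, ?_, ?_, ?_, ?_, ?_, ?_⟩
  · intro y
    rw [hasGradientAt_iff_hasFDerivAt]
    have := ((hasStrictFDerivAt_norm_sq y).hasFDerivAt).const_mul (m / 2)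
    refine this.congr_fderiv (ContinuousLinearMap.ext fun z => ?_)
    have h1 : (InnerProductSpace.toDual ℝ (EuclideanSpace ℝ (Fin 1)) (m • y)) z = m * inner ℝ y z := by
      rw [InnerProductSpace.toDual_apply_apply, real_inner_smul_left]
    rw [h1]
    change m / 2 * (2 • inner ℝ y z) = _
    rw [nsmul_eq_mul]; push_cast; ring
  · simpa using convexOn_const (0 : ℝ) convex_univ
  · intro y z
    rw [← smul_sub, norm_smul, Real.norm_of_nonneg hm.le]
    gcongr
  · intro y
    simp only [norm_zero]
    have : 0 ≤ m / 2 * ‖y‖ ^ 2 := by positivity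
    simpa using this
  · intro k
    simp only [← smul_sub, ← sub_smul, smul_smul, ← add_smul]
    congr 1
    rw [hc, ← h2ρ, ← hρ2]; ring
  · simp only [hne, sq_abs, hc0, hc1]; linarith
  · simp only [hne, sq_abs, hc0, hc1, hcu]
    have h1 : (-B) ^ 2 + A ^ 2 = A ^ 2 + B ^ 2 := by ring
    rw [h1, abs_of_pos hpos]
    have h2 : Real.sqrt 2 * (s - 1) ^ 2 / (Real.exp 1 * s) ≤ Real.sqrt (A ^ 2 + B ^ 2) := by
      apply Real.le_sqrt_of_sq_le
      refine le_trans (le_of_eq ?_) hu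
      rw [div_pow, mul_pow, mul_pow, Real.sq_sqrt (by norm_num)]
      ring
    calc _ ≤ Real.sqrt (A ^ 2 + B ^ 2) * Real.sqrt (A ^ 2 + B ^ 2) := by gcongr
      _ = _ := Real.mul_self_sqrt hpos.le
end
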